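/- arXiv:2512.13181 — 2 statements merged into one kernel-verified Lean document; each statement's English description precedes it below -/
import Mathlib

section
/- Let d ≥ 2 be an integer and n > d a real number. Let f : ℝ^d → ℝ be C² and satisfy, for all x, ξ ∈ ℝ^d, the Bakry–Émery condition Hess f(x)[ξ,ξ] ≥ (∇f(x)·ξ)²/(n−d). Let u : ℝ^d → ℝ be a non-negative C³ function satisfying Δu − ∇f·∇u + u^p = 0 on all of ℝ^d for some real p with 1 < p and (n−2)p < n+2 (i.e., p strictly below the virtual-dimension-n Sobolev exponent). Then u ≡ 0. [Euclidean-base instance of Theorem 2.6.] -/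
open Real MeasureTheory Filter
open scoped RealInnerProductSpace

/-- Euclidean Laplacian: trace of the second derivative. -/
noncomputable def lapl {d : ℕ} (u : EuclideanSpace ℝ (Fin d) → ℝ)
    (x : EuclideanSpace ℝ (Fin d)) : ℝ :=
  ∑ i : Fin d, iteratedFDeriv ℝ 2 u x ![EuclideanSpace.single i 1, EuclideanSpace.single i 1]


/-- Partial derivative. -/
noncomputable def pD {d : ℕ} (i : Fin d) (g : EuclideanSpace ℝ (Fin d) → ℝ)
    (x : EuclideanSpace ℝ (Fin d)) : ℝ := fderiv ℝ g x (EuclideanSpace.single i 1)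

lemma pD_contDiff {d : ℕ} (i : Fin d) {g : EuclideanSpace ℝ (Fin d) → ℝ} {m k : WithTop ℕ∞}
    (hg : ContDiff ℝ k g) (h : m + 1 ≤ k) : ContDiff ℝ m (pD i g) :=
  (hg.fderiv_right h).clm_apply contDiff_const

lemma lapl_eq {d : ℕ} (u : EuclideanSpace ℝ (Fin d) → ℝ) (hu : ContDiff ℝ 2 u)
    (x : EuclideanSpace ℝ (Fin d)) : lapl u x = ∑ i, pD i (pD i u) x := by
  unfold lapl
  refine Finset.sum_congr rfl fun i _ => ?_
  rw [iteratedFDeriv_two_apply]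
  simp only [Matrix.cons_val_zero, Matrix.cons_val_one]
  have h1 : DifferentiableAt ℝ (fderiv ℝ u) x :=
    ((hu.fderiv_right (m := 1) (by norm_num)).differentiable (by norm_num)) x
  unfold pD
  rw [fderiv_clm_apply h1 (differentiableAt_const _)]
  simp

lemma pD_comm {d : ℕ} (i j : Fin d) {g : EuclideanSpace ℝ (Fin d) → ℝ} (hg : ContDiff ℝ 2 g) :
    pD i (pD j g) = pD j (pD i g) := by
  ext x
  have h1 : DifferentiableAt ℝ (fderiv ℝ g) x :=
    ((hg.fderiv_right (m := 1) (by norm_num)).differentiable (by norm_num)) x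
  have hs : IsSymmSndFDerivAt ℝ g x := hg.contDiffAt.isSymmSndFDerivAt (by simp)
  have := hs (EuclideanSpace.single i 1) (EuclideanSpace.single j 1)
  have key : ∀ i j : Fin d, pD i (pD j g) x =
      fderiv ℝ (fderiv ℝ g) x (EuclideanSpace.single i 1) (EuclideanSpace.single j 1) := by
    intro i j
    unfold pD
    rw [fderiv_clm_apply h1 (differentiableAt_const _)]
    simp
  rw [key, key, this]

lemma pD_add {d : ℕ} (i : Fin d) {g h : EuclideanSpace ℝ (Fin d) → ℝ}
    (hg : Differentiable ℝ g) (hh : Differentiable ℝ h) :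
    pD i (fun x => g x + h x) = fun x => pD i g x + pD i h x := by
  ext x; unfold pD; rw [fderiv_fun_add (hg x) (hh x)]; rfl

lemma pD_sub {d : ℕ} (i : Fin d) {g h : EuclideanSpace ℝ (Fin d) → ℝ}
    (hg : Differentiable ℝ g) (hh : Differentiable ℝ h) :
    pD i (fun x => g x - h x) = fun x => pD i g x - pD i h x := by
  ext x; unfold pD; rw [fderiv_fun_sub (hg x) (hh x)]; rfl

lemma pD_mul {d : ℕ} (i : Fin d) {g h : EuclideanSpace ℝ (Fin d) → ℝ}
    (hg : Differentiable ℝ g) (hh : Differentiable ℝ h) :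
    pD i (fun x => g x * h x) = fun x => pD i g x * h x + g x * pD i h x := by
  ext x; unfold pD; rw [fderiv_fun_mul (hg x) (hh x)]
  simp; ring

lemma pD_const_mul {d : ℕ} (i : Fin d) (c : ℝ) {h : EuclideanSpace ℝ (Fin d) → ℝ}
    (hh : Differentiable ℝ h) :
    pD i (fun x => c * h x) = fun x => c * pD i h x := by
  ext x; unfold pD; rw [fderiv_const_mul (hh x)]
  simp

lemma pD_const {d : ℕ} (i : Fin d) (c : ℝ) :
    pD i (fun _ => c) = fun _ => 0 := by
  ext x; unfold pD; simp

lemma pD_sum {d : ℕ} (i : Fin d) {ι : Type*} (s : Finset ι)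
    {h : ι → EuclideanSpace ℝ (Fin d) → ℝ} (hh : ∀ j, Differentiable ℝ (h j)) :
    pD i (fun x => ∑ j ∈ s, h j x) = fun x => ∑ j ∈ s, pD i (h j) x := by
  ext x; unfold pD; rw [fderiv_fun_sum (fun j _ => hh j x)]
  simp

/-- Chain rule with a scalar outer function. -/
lemma pD_comp {d : ℕ} (i : Fin d) {φ φ' : ℝ → ℝ} {h : EuclideanSpace ℝ (Fin d) → ℝ}
    (hφ : ∀ x, HasDerivAt φ (φ' (h x)) (h x)) (hh : Differentiable ℝ h) :
    pD i (fun x => φ (h x)) = fun x => φ' (h x) * pD i h x := by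
  ext x
  have := (hφ x).comp_hasFDerivAt x (hh x).hasFDerivAt
  unfold pD
  change fderiv ℝ (φ ∘ h) x _ = _
  rw [this.fderiv]; simp

lemma pD_exp {d : ℕ} (i : Fin d) {h : EuclideanSpace ℝ (Fin d) → ℝ}
    (hh : Differentiable ℝ h) :
    pD i (fun x => exp (h x)) = fun x => exp (h x) * pD i h x :=
  pD_comp i (φ := exp) (φ' := exp) (fun _ => Real.hasDerivAt_exp _) hh

lemma pD_line {d : ℕ} (i : Fin d) {g : EuclideanSpace ℝ (Fin d) → ℝ}
    (hg : Differentiable ℝ g) (x : EuclideanSpace ℝ (Fin d)) (t : ℝ) :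
    HasDerivAt (fun t : ℝ => g (x + t • EuclideanSpace.single i 1))
      (pD i g (x + t • EuclideanSpace.single i 1)) t := by
  have h1 : HasDerivAt (fun t : ℝ => x + t • (EuclideanSpace.single i 1 : EuclideanSpace ℝ (Fin d)))
      (EuclideanSpace.single i 1) t := by
    simpa using ((hasDerivAt_id t).smul_const
      (EuclideanSpace.single i 1 : EuclideanSpace ℝ (Fin d))).const_add x
  exact (hg _).hasFDerivAt.comp_hasDerivAt t h1

lemma pD_eq_zero_of_max {d : ℕ} (i : Fin d) {g : EuclideanSpace ℝ (Fin d) → ℝ}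
    {x : EuclideanSpace ℝ (Fin d)} (hx : IsLocalMax g x) : pD i g x = 0 := by
  unfold pD; rw [hx.fderiv_eq_zero]; rfl

lemma pD_pD_nonpos_of_max {d : ℕ} (i : Fin d) {g : EuclideanSpace ℝ (Fin d) → ℝ}
    (hg : ContDiff ℝ 2 g) {x : EuclideanSpace ℝ (Fin d)} (hx : IsLocalMax g x) :
    pD i (pD i g) x ≤ 0 := by
  by_contra! hpos
  set φ : ℝ → ℝ := fun t : ℝ => g (x + t • EuclideanSpace.single i 1) with hφ
  have hd1 : deriv φ = fun t => pD i g (x + t • EuclideanSpace.single i 1) := by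
    ext t; exact (pD_line i (hg.differentiable (by norm_num)) x t).deriv
  have hd2 : deriv (deriv φ) = fun t => pD i (pD i g) (x + t • EuclideanSpace.single i 1) := by
    rw [hd1]; ext t
    exact (pD_line i ((pD_contDiff i hg (m := 1) (by norm_num)).differentiable (by norm_num)) x t).deriv
  have hcont : Continuous φ := by
    have := hg.continuous
    fun_prop
  have hmin : IsLocalMin φ 0 := by
    apply isLocalMin_of_deriv_deriv_pos
    · rw [hd2]; simpa using hpos
    · rw [hd1]; simpa using pD_eq_zero_of_max i hx
    · exact hcont.continuousAt
  have hmax : IsLocalMax φ 0 := by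
    have hc : Tendsto (fun t : ℝ => x + t • (EuclideanSpace.single i 1 : EuclideanSpace ℝ (Fin d)))
        (nhds 0) (nhds x) := by
      have : Continuous (fun t : ℝ => x + t • (EuclideanSpace.single i 1 : EuclideanSpace ℝ (Fin d))) := by
        fun_prop
      simpa using this.tendsto 0
    have := hc.eventually hx
    simpa [IsLocalMax, IsMaxFilter, hφ] using this
  have hconst : φ =ᶠ[nhds 0] fun _ => φ 0 := by
    filter_upwards [hmin, hmax] with t h1 h2 using le_antisymm h2 h1
  have h0 : deriv (deriv φ) 0 = 0 := by
    have h1 : deriv φ =ᶠ[nhds 0] deriv (fun _ => φ 0) := hconst.deriv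
    rw [h1.deriv_eq]; simp
  rw [hd2] at h0
  simp at h0
  linarith

/-- Squared distance function and its derivatives. -/
lemma pD_sqdist {d : ℕ} (i : Fin d) (x0 : EuclideanSpace ℝ (Fin d)) :
    pD i (fun x => ‖x - x0‖ ^ 2) = fun x => 2 * (x i - x0 i) := by
  ext x
  unfold pD
  have h1 : HasFDerivAt (fun x : EuclideanSpace ℝ (Fin d) => x - x0)
    (ContinuousLinearMap.id ℝ _) x := (hasFDerivAt_id x).sub_const x0
  rw [h1.norm_sq.fderiv]
  simp [EuclideanSpace.inner_single_right]

lemma pD_coord {d : ℕ} (i : Fin d) (x0 : EuclideanSpace ℝ (Fin d)) :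
    pD i (fun x => 2 * (x i - x0 i)) = fun _ => 2 := by
  ext x
  have h1 : HasFDerivAt (fun x : EuclideanSpace ℝ (Fin d) => 2 * (x i - x0 i))
    ((2 : ℝ) • (EuclideanSpace.proj i : EuclideanSpace ℝ (Fin d) →L[ℝ] ℝ)) x :=
    (((EuclideanSpace.proj i : EuclideanSpace ℝ (Fin d) →L[ℝ] ℝ).hasFDerivAt).sub_const _).const_mul 2
  unfold pD
  rw [h1.fderiv]; simp


/-- Parameter choice. -/
lemma params (N p : ℝ) (hN : 2 < N) (hp : 1 < p) (hps : (N - 2) * p < N + 2) :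
    ∃ β a κ c : ℝ, 0 < β ∧ (N - 2) * β < 2 ∧ 0 < a ∧ 0 < c ∧ ∀ X Y : ℝ, 0 ≤ X → 0 ≤ Y →
      c * (X + a * Y) ^ 2 ≤ 2 * (-κ ^ 2 * X ^ 2 + (X + Y + κ * X) ^ 2 / N)
        + (2 * κ - 2 - 2 * β) * (β * X * (X + a * Y) - a * (p - 1) * X * Y)
        - 2 * (p - 1) * X * Y + a * (p - 1) * Y * ((p - 2) * X - Y)
        - 2 * β * (a * (p - 1) * X * Y)
        + β ^ 2 * X * (X + a * Y) + β * (X + Y) * (X + a * Y) := by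
  obtain ⟨β, hβ1, hβ2⟩ : ∃ β, max (2 * (N - 1) * p / (N + 2) - 2) 0 < β ∧
      β < min (p - 1) (2 / (N - 2)) := by
    apply exists_between
    have h2 : 0 < N - 2 := by linarith
    have h3 : 0 < N + 2 := by linarith
    rw [max_lt_iff, lt_min_iff, lt_min_iff]
    refine ⟨⟨?_, ?_⟩, by linarith, by positivity⟩
    · rw [sub_lt_iff_lt_add, div_lt_iff₀ h3]; nlinarith
    · rw [sub_lt_iff_lt_add, div_lt_iff₀ h3]
      have : (2 / (N - 2) + 2) * (N + 2) = 2 * (N - 1) * ((N + 2) / (N - 2)) := by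
        field_simp; ring
      rw [this]
      have h4 : p < (N + 2) / (N - 2) := by rw [lt_div_iff₀ h2]; linarith
      exact mul_lt_mul_of_pos_left h4 (by linarith)
  rw [max_lt_iff] at hβ1
  rw [lt_min_iff] at hβ2
  obtain ⟨hb1, hb0⟩ := hβ1
  obtain ⟨hb2, hb3⟩ := hβ2
  have h2 : 0 < N - 2 := by linarith
  have hN1 : 0 < N - 1 := by linarith
  have hN0 : 0 < N := by linarith
  rw [lt_div_iff₀ h2] at hb3
  rw [sub_lt_iff_lt_add, div_lt_iff₀ (by linarith)] at hb1
  set B0 : ℝ := ((N + 2) * (2 + β) - 2 * (N - 1) * p) / N with hB0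
  have hB0p : 0 < B0 := by apply div_pos _ hN0; nlinarith
  set δ := min (1 / N) (B0 / (2 * (p + β))) with hδ
  have hδ0 : 0 < δ := by
    rw [hδ, lt_min_iff]; constructor <;> positivity
  have hδ1 : δ ≤ 1 / N := min_le_left _ _
  have hδ2 : δ * (2 * (p + β)) ≤ B0 := by
    rw [← le_div_iff₀ (by positivity)]; exact min_le_right _ _
  have hpb : 0 < p - 1 - β := by linarith
  set κ := (N * β / 2 + 1) / (N - 1) with hκ
  have hκ0 : 0 < κ := by positivity
  set s := 2 / N - δ with hs
  have hs0 : 0 < s := by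
    have : 2 / N = 1 / N + 1 / N := by ring
    have : 0 < 1 / N := by positivity
    linarith
  set a := s / (p - 1 - β) with ha
  have ha0 : 0 < a := by positivity
  have has : a * (p - 1 - β) = s := by rw [ha]; field_simp
  set A := (2 - (N - 2) * β) * (β + 2) / (2 * (N - 1)) with hA
  have hA0 : 0 < A := by
    apply div_pos _ (by linarith)
    apply mul_pos <;> linarith
  set B := B0 + δ * (2 * κ - (p + β)) with hB
  have hB1 : 0 < B := by nlinarith [mul_pos hδ0 hκ0]
  refine ⟨β, a, κ, min A (min (δ / a ^ 2) (B / (2 * a))), hb0, by linarith, ha0, ?_, ?_⟩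
  · rw [lt_min_iff, lt_min_iff]
    exact ⟨hA0, by positivity, by positivity⟩
  intro X Y hX hY
  set c := min A (min (δ / a ^ 2) (B / (2 * a))) with hc
  have hc1 : c ≤ A := min_le_left _ _
  have hc2 : c * a ^ 2 ≤ δ := by
    rw [← le_div_iff₀ (by positivity)]
    exact (min_le_right _ _).trans (min_le_left _ _)
  have hc3 : c * (2 * a) ≤ B := by
    rw [← le_div_iff₀ (by positivity)]
    exact (min_le_right _ _).trans (min_le_right _ _)
  have hE : 2 * (-κ ^ 2 * X ^ 2 + (X + Y + κ * X) ^ 2 / N)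
        + (2 * κ - 2 - 2 * β) * (β * X * (X + a * Y) - a * (p - 1) * X * Y)
        - 2 * (p - 1) * X * Y + a * (p - 1) * Y * ((p - 2) * X - Y)
        - 2 * β * (a * (p - 1) * X * Y)
        + β ^ 2 * X * (X + a * Y) + β * (X + Y) * (X + a * Y)
        = A * X ^ 2 + B * (X * Y) + δ * Y ^ 2 := by
    have e1 : 2 * (-κ ^ 2 + (1 + κ) ^ 2 / N) + (2 * κ - 2 - 2 * β) * β + β ^ 2 + β = A := by
      rw [hA, hκ]; field_simp; ring
    have e2 : 4 * (1 + κ) / N - 2 * κ * s + s * (p + β) - 2 * (p - 1) + β = B := by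
      rw [hB, hB0, hs]; field_simp; ring
    have e3 : 2 / N - s = δ := by rw [hs]; ring
    rw [← e1, ← e2, ← e3, ← has]
    ring
  rw [hE]
  have := mul_le_mul_of_nonneg_right hc1 (sq_nonneg X)
  have := mul_le_mul_of_nonneg_right hc2 (sq_nonneg Y)
  have := mul_le_mul_of_nonneg_right hc3 (mul_nonneg hX hY)
  nlinarith

/-- Scalar conclusion at the maximum point. -/
lemma scalar_est (c K D : ℝ) (hc : 0 < c) (hD : 0 ≤ D) : ∃ C : ℝ, 0 ≤ C ∧
    ∀ R η G L P X : ℝ, 0 < R → 0 < η → η ≤ R ^ 2 → 0 < G → 0 ≤ X → X ≤ G → L ≤ 4 * R ^ 2 → 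
      P ^ 2 ≤ L * X →
      η ^ 2 * (c * G ^ 2) ≤ 6 * L * G + 4 * D * η * G + 4 * K * (η * P * G) →
      η ^ 2 * G ≤ C * R ^ 2 := by
  refine ⟨(2 * (24 + 4 * D) * c + 64 * K ^ 2) / c ^ 2, by positivity, ?_⟩
  intro R η G L P X hR hη hηR hG hX hXG hL hP h
  have h1 : η ^ 2 * (c * G) ≤ 6 * L + 4 * D * η + 4 * K * (η * P) := by
    have : (η ^ 2 * (c * G)) * G ≤ (6 * L + 4 * D * η + 4 * K * (η * P)) * G := by nlinarith
    exact le_of_mul_le_mul_right this hG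
  have h2 : P ^ 2 ≤ 4 * R ^ 2 * G := by
    refine hP.trans ?_
    calc L * X ≤ 4 * R ^ 2 * X := mul_le_mul_of_nonneg_right hL hX
      _ ≤ _ := mul_le_mul_of_nonneg_left hXG (by positivity)
  have h3 : 4 * D * η ≤ 4 * D * R ^ 2 := mul_le_mul_of_nonneg_left hηR (by positivity)
  have h4 : 4 * K * (η * P) * (8 * c * R ^ 2) ≤ c ^ 2 * (η * P) ^ 2 + 64 * K ^ 2 * R ^ 4 * 4 := by
    nlinarith [sq_nonneg (c * (η * P) - 16 * K * R ^ 2)]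
  have h5 : c ^ 2 * (η * P) ^ 2 ≤ c ^ 2 * η ^ 2 * (4 * R ^ 2 * G) := by
    rw [mul_pow, ← mul_assoc]
    exact mul_le_mul_of_nonneg_left h2 (by positivity)
  have h6 : 4 * K * (η * P) * c ≤ c ^ 2 * η ^ 2 * G / 2 + 32 * K ^ 2 * R ^ 2 := by
    have : (4 * K * (η * P) * c) * (8 * R ^ 2) ≤
      (c ^ 2 * η ^ 2 * G / 2 + 32 * K ^ 2 * R ^ 2) * (8 * R ^ 2) := by nlinarith
    exact le_of_mul_le_mul_right this (by positivity)
  rw [div_mul_eq_mul_div, le_div_iff₀ (by positivity)]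
  have h7 : c * (η ^ 2 * (c * G)) ≤ c * ((24 + 4 * D) * R ^ 2 + 4 * K * (η * P)) :=
    mul_le_mul_of_nonneg_left (by linarith) hc.le
  nlinarith


lemma max_conditions {d : ℕ} {η w G : EuclideanSpace ℝ (Fin d) → ℝ} (β : ℝ)
    (hη : ContDiff ℝ 2 η) (hw : ContDiff ℝ 2 w) (hG : ContDiff ℝ 2 G)
    {x : EuclideanSpace ℝ (Fin d)}
    (hmax : IsLocalMax (fun x => (η x * η x) * (exp (-β * w x) * G x)) x) (hpos : 0 < η x)
    (i : Fin d) :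
    η x * (pD i G x - β * pD i w x * G x) = -2 * pD i η x * G x ∧
    -6 * (pD i η x) ^ 2 * G x + 2 * η x * pD i (pD i η) x * G x
      + (η x) ^ 2 * (pD i (pD i G) x - 2 * β * (pD i w x * pD i G x)
        + β ^ 2 * (pD i w x) ^ 2 * G x - β * pD i (pD i w) x * G x) ≤ 0 := by
  have dη : Differentiable ℝ η := hη.differentiable (by norm_num)
  have dw : Differentiable ℝ w := hw.differentiable (by norm_num)
  have dG : Differentiable ℝ G := hG.differentiable (by norm_num)
  have dη1 : Differentiable ℝ (pD i η) :=
    (pD_contDiff i hη (m := 1) (by norm_num)).differentiable (by norm_num)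
  have dw1 : Differentiable ℝ (pD i w) :=
    (pD_contDiff i hw (m := 1) (by norm_num)).differentiable (by norm_num)
  have dG1 : Differentiable ℝ (pD i G) :=
    (pD_contDiff i hG (m := 1) (by norm_num)).differentiable (by norm_num)
  have dE : Differentiable ℝ (fun x => exp (-β * w x)) := by fun_prop
  have hE : pD i (fun x => exp (-β * w x)) = fun x => exp (-β * w x) * (-β * pD i w x) := by
    rw [pD_exp i (by fun_prop), pD_const_mul i _ dw]
  have hΦ : ContDiff ℝ 2 (fun x => (η x * η x) * (exp (-β * w x) * G x)) := by fun_prop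
  have h1 : pD i (fun x => (η x * η x) * (exp (-β * w x) * G x)) = fun x =>
      (pD i η x * η x + η x * pD i η x) * (exp (-β * w x) * G x) + (η x * η x) *
      (exp (-β * w x) * (-β * pD i w x) * G x + exp (-β * w x) * pD i G x) := by
    rw [pD_mul i (by fun_prop) (by fun_prop), pD_mul i dη dη, pD_mul i dE dG, hE]
  have a1 := pD_eq_zero_of_max i hmax
  have a2 := pD_pD_nonpos_of_max i hΦ hmax
  rw [h1] at a1 a2
  rw [pD_add i (by fun_prop) (by fun_prop), pD_mul i (by fun_prop) (by fun_prop),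
    pD_add i (by fun_prop) (by fun_prop), pD_mul i dη1 dη, pD_mul i dη dη1, pD_mul i dE dG,
    pD_mul i (by fun_prop) (by fun_prop), pD_mul i dη dη, pD_add i (by fun_prop) (by fun_prop),
    pD_mul i (by fun_prop) dG, pD_mul i dE (by fun_prop), pD_mul i dE dG1,
    pD_const_mul i _ dw1, hE] at a2
  simp only at a1 a2
  have hexp : 0 < exp (-β * w x) := exp_pos _
  generalize exp (-β * w x) = e at a1 a2 hexp
  have b1 : η x * (pD i G x - β * pD i w x * G x) = -2 * pD i η x * G x := by
    have : (η x * e) * (η x * (pD i G x - β * pD i w x * G x)) =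
        (η x * e) * (-2 * pD i η x * G x) := by linear_combination a1
    exact mul_left_cancel₀ (by positivity) this
  refine ⟨b1, ?_⟩
  refine le_of_mul_le_mul_left ?_ hexp
  rw [mul_zero]
  refine le_of_eq_of_le ?_ a2
  linear_combination (-4 * e * pD i η x) * b1

lemma bochner {d : ℕ} {w : EuclideanSpace ℝ (Fin d) → ℝ} (hw : ContDiff ℝ 3 w) (a q : ℝ)
    (heq : ∀ x, ∑ i, pD i (pD i w) x = -(∑ j, pD j w x * pD j w x) - exp (q * w x)) :
    ContDiff ℝ 2 (fun x => (∑ j, pD j w x * pD j w x) + a * exp (q * w x)) ∧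
    (∀ i x, pD i (fun x => (∑ j, pD j w x * pD j w x) + a * exp (q * w x)) x =
      2 * (∑ j, pD i (pD j w) x * pD j w x) + a * q * exp (q * w x) * pD i w x) ∧
    (∀ x, ∑ i, pD i (pD i (fun x => (∑ j, pD j w x * pD j w x) + a * exp (q * w x))) x =
      2 * (∑ i, ∑ j, (pD i (pD j w) x) ^ 2)
      - 4 * (∑ i, ∑ j, pD i (pD j w) x * pD j w x * pD i w x)
      - 2 * q * exp (q * w x) * (∑ j, pD j w x * pD j w x)
      + a * q * exp (q * w x) * ((q - 1) * (∑ j, pD j w x * pD j w x) - exp (q * w x))) := by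
  have cw1 : ∀ i, ContDiff ℝ 2 (pD i w) := fun i => pD_contDiff i hw (by norm_num)
  have cw2 : ∀ i j, ContDiff ℝ 1 (pD i (pD j w)) := fun i j => pD_contDiff i (cw1 j) (by norm_num)
  have dw : Differentiable ℝ w := hw.differentiable (by norm_num)
  have dw1 : ∀ i, Differentiable ℝ (pD i w) := fun i => (cw1 i).differentiable (by norm_num)
  have dw2 : ∀ i j, Differentiable ℝ (pD i (pD j w)) :=
    fun i j => (cw2 i j).differentiable (by norm_num)
  have hY : ∀ i, pD i (fun x => exp (q * w x)) = fun x => exp (q * w x) * (q * pD i w x) := by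
    intro i
    rw [pD_exp i (by fun_prop), pD_const_mul i _ dw]
  have hX : ∀ i, pD i (fun x => ∑ j, pD j w x * pD j w x) =
      fun x => ∑ j, 2 * (pD i (pD j w) x * pD j w x) := by
    intro i
    rw [pD_sum i _ (h := fun j x => pD j w x * pD j w x) (fun j => (dw1 j).mul (dw1 j))]
    ext x
    refine Finset.sum_congr rfl fun j _ => ?_
    rw [pD_mul i (dw1 j) (dw1 j)]; ring
  have dX : Differentiable ℝ (fun x => ∑ j, pD j w x * pD j w x) := by fun_prop
  have hG : ∀ i, pD i (fun x => (∑ j, pD j w x * pD j w x) + a * exp (q * w x)) =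
      fun x => (∑ j, 2 * (pD i (pD j w) x * pD j w x)) + a * (exp (q * w x) * (q * pD i w x)) := by
    intro i
    rw [pD_add i dX (by fun_prop), hX, pD_const_mul i _ (by fun_prop), hY]
  have hw2 : ContDiff ℝ 2 w := hw.of_le (by norm_num)
  refine ⟨?_, ?_, ?_⟩
  · fun_prop
  · intro i x
    rw [hG]; simp only [← Finset.mul_sum]; ring
  · intro x
    have h3 : ∀ j, ∑ i, pD i (pD i (pD j w)) x =
        -2 * (∑ i, pD i (pD j w) x * pD i w x) - q * exp (q * w x) * pD j w x := by
      intro j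
      have e1 : ∀ i, pD i (pD i (pD j w)) = pD j (pD i (pD i w)) := by
        intro i
        rw [pD_comm i j hw2, pD_comm i j (cw1 i)]
      have e2 : pD j (fun x => ∑ i, pD i (pD i w) x) x = ∑ i, pD j (pD i (pD i w)) x := by
        rw [pD_sum j _ (fun i => dw2 i i)]
      simp only [e1]
      rw [← e2]
      have e3 : (fun x => ∑ i, pD i (pD i w) x) =
        fun x => (-1) * (∑ j, pD j w x * pD j w x) - exp (q * w x) := by
        ext y; rw [heq y]; ring
      rw [e3, pD_sub j (by fun_prop) (by fun_prop), pD_const_mul j _ dX, hX, hY]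
      simp only [← Finset.mul_sum]
      simp only [pD_comm j _ hw2]
      ring
    have h4 : ∀ i, pD i (pD i (fun x => (∑ j, pD j w x * pD j w x) + a * exp (q * w x))) x =
        2 * (∑ j, (pD i (pD i (pD j w)) x * pD j w x)) + 2 * (∑ j, (pD i (pD j w) x) ^ 2) +
        a * q * exp (q * w x) * (q * (pD i w x * pD i w x) + pD i (pD i w) x) := by
      intro i
      rw [hG, pD_add i (by fun_prop) (by fun_prop), pD_sum i _ (by fun_prop),
        pD_const_mul i _ (by fun_prop), pD_mul i (by fun_prop) (by fun_prop), hY,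
        pD_const_mul i _ (dw1 i)]
      have : ∀ j, pD i (fun x => 2 * (pD i (pD j w) x * pD j w x)) x =
          2 * (pD i (pD i (pD j w)) x * pD j w x) + 2 * (pD i (pD j w) x) ^ 2 := by
        intro j
        rw [pD_const_mul i _ (by fun_prop), pD_mul i (dw2 i j) (dw1 j)]; ring
      simp only [this, Finset.sum_add_distrib, ← Finset.mul_sum]
      ring
    simp only [h4, Finset.sum_add_distrib, ← Finset.mul_sum]
    rw [heq x, Finset.sum_comm (f := fun i j => pD i (pD i (pD j w)) x * pD j w x)]
    have h5 : ∑ j, (-2 * (∑ i, pD i (pD j w) x * pD i w x) - q * exp (q * w x) * pD j w x) * pD j w x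
      = -2 * (∑ i, ∑ j, pD i (pD j w) x * pD j w x * pD i w x)
        - q * exp (q * w x) * (∑ j, pD j w x * pD j w x) := by
      rw [Finset.sum_comm, Finset.mul_sum, Finset.mul_sum, ← Finset.sum_sub_distrib]
      refine Finset.sum_congr rfl fun j _ => ?_
      rw [sub_mul, mul_assoc (-2 : ℝ), Finset.sum_mul]
      congr 1
      · congr 1
        refine Finset.sum_congr rfl fun i _ => ?_
        ring
      · ring
    have h6 : ∑ j, ∑ i, pD i (pD i (pD j w)) x * pD j w x =
        ∑ j, (-2 * (∑ i, pD i (pD j w) x * pD i w x) - q * exp (q * w x) * pD j w x) * pD j w x := by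
      refine Finset.sum_congr rfl fun j _ => ?_
      rw [← h3, Finset.sum_mul]
    rw [h6, h5]
    ring

/-- Refined Cauchy-Schwarz. -/
lemma hess_lower {d : ℕ} (N κ t : ℝ) (hN : 0 < N) (hdN : (d : ℝ) ≤ N) (h : Fin d → Fin d → ℝ)
    (g : Fin d → ℝ) (ht : ∑ i, h i i = t) :
    2 * κ * (∑ i, ∑ j, h i j * g j * g i) - κ ^ 2 * (∑ j, g j * g j) ^ 2
      + (t - κ * (∑ j, g j * g j)) ^ 2 / N ≤ ∑ i, ∑ j, (h i j) ^ 2 := by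
  set X := ∑ j, g j * g j with hX
  set θ := (t - κ * X) / N with hθ
  have key : ∀ θ : ℝ, 0 ≤ (∑ i, ∑ j, (h i j) ^ 2) + d * θ ^ 2 + κ ^ 2 * X ^ 2 - 2 * θ * t
      - 2 * κ * (∑ i, ∑ j, h i j * g j * g i) + 2 * θ * κ * X := by
    intro θ
    have h0 : 0 ≤ ∑ i, ∑ j, (h i j - (if i = j then θ else 0) - κ * (g j * g i)) ^ 2 :=
      Finset.sum_nonneg fun i _ => Finset.sum_nonneg fun j _ => sq_nonneg _
    refine h0.trans_eq ?_
    have h1 : ∀ i j, (h i j - (if i = j then θ else 0) - κ * (g j * g i)) ^ 2 =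
        (h i j) ^ 2 + κ ^ 2 * ((g j * g j) * (g i * g i)) - 2 * κ * (h i j * g j * g i)
        + (if i = j then θ ^ 2 - 2 * θ * h i j + 2 * θ * κ * (g j * g i) else 0) := by
      intro i j
      split_ifs <;> ring
    simp only [h1, Finset.sum_add_distrib, Finset.sum_sub_distrib, Finset.sum_ite_eq,
      Finset.mem_univ, if_true, ← Finset.mul_sum, ← Finset.sum_mul, ht, ← hX]
    simp
    ring
  have k := key θ
  have : (d : ℝ) * θ ^ 2 ≤ N * θ ^ 2 := mul_le_mul_of_nonneg_right hdN (sq_nonneg _)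
  have e : (t - κ * X) ^ 2 / N = 2 * θ * (t - κ * X) - N * θ ^ 2 := by
    rw [hθ]; field_simp; ring
  rw [e]
  linarith


lemma combine_scalar (η c G L P X Y S Q β κ a p d T : ℝ)
    (g3 : -6 * L * G - 4 * d * η * G + η ^ 2 *
        ((2 * S - 4 * Q - 2 * (p - 1) * Y * X + a * (p - 1) * Y * ((p - 1 - 1) * X - Y))
          - 2 * β * (2 * Q + a * (p - 1) * X * Y) + β ^ 2 * X * G + β * (X + Y) * G) ≤ 0)
    (g4 : 2 * κ * Q - κ ^ 2 * X ^ 2 + T ≤ S)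
    (g5 : c * G ^ 2 ≤ 2 * (-κ ^ 2 * X ^ 2 + T)
        + (2 * κ - 2 - 2 * β) * (β * X * G - a * (p - 1) * X * Y)
        - 2 * (p - 1) * X * Y + a * (p - 1) * Y * ((p - 2) * X - Y)
        - 2 * β * (a * (p - 1) * X * Y)
        + β ^ 2 * X * G + β * (X + Y) * G)
    (g2 : η * (2 * Q + a * (p - 1) * X * Y) = η * (β * X * G) - 2 * P * G) :
    η ^ 2 * (c * G ^ 2) ≤ 6 * L * G + 4 * d * η * G + 4 * (κ - 1 - β) * (η * P * G) := by
  have g7 := mul_le_mul_of_nonneg_left g5 (sq_nonneg η)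
  have g8 := mul_le_mul_of_nonneg_left g4 (sq_nonneg η)
  have g9 : η ^ 2 * ((2 * κ - 2 - 2 * β) * (2 * Q + a * (p - 1) * X * Y)) =
      (2 * κ - 2 - 2 * β) * η * (η * (β * X * G) - 2 * P * G) := by
    rw [← g2]; ring
  linarith [g3, g7, g8, g9]


lemma max_est {d : ℕ} {w : EuclideanSpace ℝ (Fin d) → ℝ} (hw : ContDiff ℝ 3 w)
    (N p β a κ c : ℝ) (hN : 0 < N) (hdN : (d : ℝ) ≤ N) (ha : 0 < a) (hc : 0 < c)
    (hE : ∀ X Y : ℝ, 0 ≤ X → 0 ≤ Y →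
      c * (X + a * Y) ^ 2 ≤ 2 * (-κ ^ 2 * X ^ 2 + (X + Y + κ * X) ^ 2 / N)
        + (2 * κ - 2 - 2 * β) * (β * X * (X + a * Y) - a * (p - 1) * X * Y)
        - 2 * (p - 1) * X * Y + a * (p - 1) * Y * ((p - 2) * X - Y)
        - 2 * β * (a * (p - 1) * X * Y)
        + β ^ 2 * X * (X + a * Y) + β * (X + Y) * (X + a * Y))
    (heq : ∀ x, ∑ i, pD i (pD i w) x = -(∑ j, pD j w x * pD j w x) - exp ((p - 1) * w x)) :
    ∃ C : ℝ, 0 ≤ C ∧ ∀ (x0 : EuclideanSpace ℝ (Fin d)) (R : ℝ), 0 < R →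
      ∃ x1, ‖x1 - x0‖ ≤ R ∧
      R ^ 4 * (exp (-β * w x0) * ((∑ j, pD j w x0 * pD j w x0) + a * exp ((p - 1) * w x0)))
        ≤ C * R ^ 2 * exp (-β * w x1) := by
  obtain ⟨C, hC0, hC⟩ := scalar_est c (κ - 1 - β) d hc (Nat.cast_nonneg d)
  refine ⟨C, hC0, fun x0 R hR => ?_⟩
  obtain ⟨cG, hG1, hG2⟩ := bochner hw a (p - 1) heq
  set G := fun x => (∑ j, pD j w x * pD j w x) + a * exp ((p - 1) * w x) with hGdef
  have hGpos : ∀ x, 0 < G x := by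
    intro x
    have : 0 ≤ ∑ j, pD j w x * pD j w x := Finset.sum_nonneg fun j _ => mul_self_nonneg _
    have := exp_pos ((p - 1) * w x)
    simp only [hGdef]; positivity
  set η := fun x : EuclideanSpace ℝ (Fin d) => R ^ 2 - ‖x - x0‖ ^ 2 with hηdef
  have cq : ContDiff ℝ 2 (fun x : EuclideanSpace ℝ (Fin d) => ‖x - x0‖ ^ 2) :=
    (contDiff_id.sub contDiff_const).norm_sq ℝ
  have cη : ContDiff ℝ 2 η := contDiff_const.sub cq
  have cw : ContDiff ℝ 2 w := hw.of_le (by norm_num)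
  have hη1 : ∀ i, pD i η = fun x => -1 * (2 * (x i - x0 i)) := by
    intro i
    rw [hηdef, pD_sub i (differentiable_const _) (cq.differentiable (by norm_num)), pD_const,
      pD_sqdist]
    ext x; ring
  have hη2 : ∀ i x, pD i (pD i η) x = -2 := by
    intro i x
    rw [hη1, pD_const_mul i, pD_coord]
    · norm_num
    · fun_prop
  set Φ := fun x => (η x * η x) * (exp (-β * w x) * G x) with hΦ
  have cΦ : ContDiff ℝ 2 Φ := by fun_prop
  obtain ⟨x1, hx1, hmax⟩ := (isCompact_closedBall x0 R).exists_isMaxOn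
    ⟨x0, Metric.mem_closedBall_self hR.le⟩ cΦ.continuous.continuousOn
  have hx1' : ‖x1 - x0‖ ≤ R := by rwa [mem_closedBall_iff_norm] at hx1
  have h0 : Φ x0 ≤ Φ x1 := hmax (Metric.mem_closedBall_self hR.le)
  have hη0 : η x0 = R ^ 2 := by simp [hηdef]
  have hΦ0 : Φ x0 = R ^ 4 * (exp (-β * w x0) * G x0) := by
    simp only [hΦ, hη0]; ring
  have hΦ0pos : 0 < Φ x0 := by
    rw [hΦ0]; have := hGpos x0; positivity
  have hlt : ‖x1 - x0‖ < R := by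
    refine lt_of_le_of_ne hx1' fun h => ?_
    have : Φ x1 = 0 := by simp [hΦ, hηdef, h]
    linarith
  have hloc : IsLocalMax Φ x1 := by
    refine hmax.isLocalMax (Metric.closedBall_mem_nhds_of_mem ?_)
    rwa [mem_ball_iff_norm]
  have hηpos : 0 < η x1 := by
    simp only [hηdef]
    have := norm_nonneg (x1 - x0)
    nlinarith
  have hηle : η x1 ≤ R ^ 2 := by
    simp only [hηdef]; nlinarith [sq_nonneg ‖x1 - x0‖]
  have hcond := max_conditions β cη cw cG hloc hηpos
  refine ⟨x1, hx1', ?_⟩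
  rw [← hΦ0]
  have main : (η x1) ^ 2 * G x1 ≤ C * R ^ 2 := by
    set X := ∑ j, pD j w x1 * pD j w x1 with hX
    set Y := exp ((p - 1) * w x1) with hY
    have hX0 : 0 ≤ X := Finset.sum_nonneg fun j _ => mul_self_nonneg _
    have hY0 : 0 < Y := exp_pos _
    have hGx : G x1 = X + a * Y := rfl
    set L := ∑ i, (pD i η x1) ^ 2 with hL
    set P := ∑ i, pD i η x1 * pD i w x1 with hP
    set S := ∑ i, ∑ j, (pD i (pD j w) x1) ^ 2 with hS
    set Q := ∑ i, ∑ j, pD i (pD j w) x1 * pD j w x1 * pD i w x1 with hQ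
    have hL4 : L ≤ 4 * R ^ 2 := by
      have : L = 4 * ‖x1 - x0‖ ^ 2 := by
        rw [hL, EuclideanSpace.norm_sq_eq, Finset.mul_sum]
        refine Finset.sum_congr rfl fun i _ => ?_
        rw [hη1]; simp; ring
      rw [this]
      have := norm_nonneg (x1 - x0)
      nlinarith
    have hPL : P ^ 2 ≤ L * X := by
      have := Finset.sum_mul_sq_le_sq_mul_sq Finset.univ (fun i => pD i η x1) (fun i => pD i w x1)
      simpa [hP, hL, hX, pow_two] using this
    refine hC R (η x1) (G x1) L P X hR hηpos hηle (hGpos x1) hX0 ?_ hL4 hPL ?_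
    · rw [hGx]; nlinarith
    have g1 : ∑ i, pD i w x1 * pD i G x1 = 2 * Q + a * (p - 1) * X * Y := by
      have : ∀ i, pD i w x1 * pD i G x1 = 2 * (∑ j, pD i (pD j w) x1 * pD j w x1 * pD i w x1)
          + a * (p - 1) * Y * (pD i w x1 * pD i w x1) := by
        intro i
        rw [hG1, ← Finset.sum_mul]; ring
      simp only [this, Finset.sum_add_distrib, ← Finset.mul_sum]
      rw [← hQ, ← hX]; ring
    have g2 : η x1 * (2 * Q + a * (p - 1) * X * Y) = η x1 * (β * X * G x1) - 2 * P * G x1 := by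
      rw [← g1]
      have : ∀ i, η x1 * (pD i w x1 * pD i G x1) =
          η x1 * (β * (pD i w x1 * pD i w x1) * G x1)
            - 2 * (pD i η x1 * pD i w x1) * G x1 := by
        intro i
        linear_combination (pD i w x1) * (hcond i).1
      rw [Finset.mul_sum]
      simp only [this, Finset.sum_sub_distrib, ← Finset.mul_sum, ← Finset.sum_mul]
      rw [← hX, ← hP]
    have g3 : -6 * L * G x1 - 4 * d * η x1 * G x1 + (η x1) ^ 2 *
        ((2 * S - 4 * Q - 2 * (p - 1) * Y * X + a * (p - 1) * Y * ((p - 1 - 1) * X - Y))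
          - 2 * β * (2 * Q + a * (p - 1) * X * Y) + β ^ 2 * X * G x1 + β * (X + Y) * G x1) ≤ 0 := by
      have hsum := Finset.sum_nonpos (s := Finset.univ) fun i _ => (hcond i).2
      simp only [hη2, Finset.sum_add_distrib, Finset.sum_sub_distrib, ← Finset.mul_sum,
        ← Finset.sum_mul] at hsum
      rw [hG2 x1, g1, heq x1, ← hL] at hsum
      have e : ∑ i, (pD i w x1) ^ 2 = X := by simp only [hX, pow_two]
      rw [e] at hsum
      simp only [Finset.sum_const, Finset.card_univ, Fintype.card_fin, nsmul_eq_mul] at hsum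
      refine le_of_eq_of_le ?_ hsum
      ring
    have g4 := hess_lower N κ (-X - Y) hN hdN (fun i j => pD i (pD j w) x1) (fun j => pD j w x1)
      (heq x1)
    rw [← hS, ← hQ, ← hX] at g4
    have g5 := hE X Y hX0 hY0.le
    rw [← hGx] at g5
    have g6 : (-X - Y - κ * X) ^ 2 / N = (X + Y + κ * X) ^ 2 / N := by ring
    rw [g6] at g4
    exact combine_scalar _ _ _ _ _ _ _ _ _ _ _ _ _ _ _ g3 g4 g5 g2
  calc Φ x0 ≤ Φ x1 := h0
    _ = ((η x1) ^ 2 * G x1) * exp (-β * w x1) := by simp only [hΦ]; ring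
    _ ≤ _ := mul_le_mul_of_nonneg_right main (exp_pos _).le


lemma lower_bound {d : ℕ} {u : EuclideanSpace ℝ (Fin d) → ℝ} (hu : ContDiff ℝ 2 u)
    (hnn : ∀ x, 0 ≤ u x) (hsup : ∀ x, ∑ i, pD i (pD i u) x ≤ 0) (α : ℝ) (hα : 0 < α)
    (hαd : (d : ℝ) < α + 2) (x0 : EuclideanSpace ℝ (Fin d)) (hx0 : 0 < u x0) :
    ∃ c R0 : ℝ, 0 < c ∧ 0 < R0 ∧ ∀ R, R0 ≤ R → ∀ x, ‖x - x0‖ ≤ R →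
      c * (R ^ 2) ^ (-(α / 2)) ≤ u x := by
  obtain ⟨r, hr, hball⟩ : ∃ r > 0, ∀ x, ‖x - x0‖ ≤ r → u x0 / 2 ≤ u x := by
    have h1 : ∀ᶠ x in nhds x0, u x0 / 2 < u x :=
      hu.continuous.continuousAt.eventually (lt_mem_nhds (by linarith))
    obtain ⟨r, hr, h⟩ := Metric.nhds_basis_closedBall.eventually_iff.1 h1
    exact ⟨r, hr, fun x hx => (h (by rwa [mem_closedBall_iff_norm])).le⟩
  set ε := (α + 2 - d) * r ^ 2 / (α + 2) with hε
  have hε0 : 0 < ε := by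
    have : 0 < α + 2 - d := by linarith
    positivity
  have hεr : (α + 2) * ε = (α + 2 - d) * r ^ 2 := by rw [hε]; field_simp
  set q := fun x : EuclideanSpace ℝ (Fin d) => ‖x - x0‖ ^ 2 + ε with hq
  have hqpos : ∀ x, 0 < q x := fun x => by simp only [hq]; positivity
  have cq : ContDiff ℝ 2 q := ((contDiff_id.sub contDiff_const).norm_sq ℝ).add contDiff_const
  have dq : Differentiable ℝ q := cq.differentiable (by norm_num)
  have hpow : ∀ (s : ℝ) i, pD i (fun x => (q x) ^ s) = fun x => s * (q x) ^ (s - 1) * pD i q x := by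
    intro s i
    exact pD_comp i (φ := fun t => t ^ s) (φ' := fun t => s * t ^ (s - 1))
      (fun x => Real.hasDerivAt_rpow_const (Or.inl (hqpos x).ne')) dq
  have cpow : ∀ s : ℝ, ContDiff ℝ 2 (fun x => (q x) ^ s) := fun s =>
    cq.rpow_const_of_ne fun x => (hqpos x).ne'
  have dpow : ∀ s : ℝ, Differentiable ℝ (fun x => (q x) ^ s) := fun s =>
    (cpow s).differentiable (by norm_num)
  have hq1 : ∀ i, pD i q = fun x => 2 * (x i - x0 i) := by
    intro i
    have dn : Differentiable ℝ (fun x : EuclideanSpace ℝ (Fin d) => ‖x - x0‖ ^ 2) :=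
      ((contDiff_id.sub contDiff_const).norm_sq ℝ).differentiable (n := 2) (by norm_num)
    rw [hq, pD_add i dn (differentiable_const _), pD_const, pD_sqdist]
    simp
  set A := α / 2 with hA
  have hA0 : 0 < A := by positivity
  have hb2 : ∀ i x, pD i (pD i (fun x => (q x) ^ (-A))) x =
      A * (A + 1) * (q x) ^ (-A - 2) * (4 * (x i - x0 i) ^ 2) - 2 * A * (q x) ^ (-A - 2) * q x := by
    intro i x
    have e : (q x) ^ (-A - 1) = (q x) ^ (-A - 2) * q x := by
      rw [← Real.rpow_add_one (hqpos x).ne']; congr 1; ring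
    rw [hpow, hq1, pD_mul i ((dpow _).const_mul _) (by fun_prop), pD_const_mul i _ (dpow _), hpow,
      hq1, pD_coord]
    simp only
    rw [e, show -A - 1 - 1 = -A - 2 by ring]
    ring
  have hlap : ∀ x, ∑ i, pD i (pD i (fun x => (q x) ^ (-A))) x =
      2 * A * (q x) ^ (-A - 2) * ((α + 2 - d) * q x - (α + 2) * ε) := by
    intro x
    simp only [hb2, Finset.sum_sub_distrib, ← Finset.mul_sum]
    have : ∑ i, (x i - x0 i) ^ 2 = q x - ε := by
      simp [hq, EuclideanSpace.norm_sq_eq]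
    rw [this]
    simp only [Finset.sum_const, Finset.card_univ, Fintype.card_fin, nsmul_eq_mul]
    have hα2 : α = 2 * A := by rw [hA]; ring
    rw [hα2]; ring
  set M := u x0 / 2 * ε ^ A with hM
  have hM0 : 0 < M := by positivity
  have hbM : ∀ x, M * (q x) ^ (-A) ≤ u x0 / 2 := by
    intro x
    have h1 : (q x) ^ (-A) ≤ ε ^ (-A) :=
      Real.rpow_le_rpow_of_nonpos hε0 (by simp only [hq]; nlinarith [sq_nonneg ‖x - x0‖]) (by linarith)
    calc M * (q x) ^ (-A) ≤ M * ε ^ (-A) := mul_le_mul_of_nonneg_left h1 hM0.le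
      _ = u x0 / 2 := by rw [hM, mul_assoc, ← Real.rpow_add hε0]; simp
  refine ⟨M * (2 ^ (-A) - 4 ^ (-A)), r + Real.sqrt ε, ?_, by positivity, ?_⟩
  · apply mul_pos hM0
    rw [sub_pos]
    exact Real.rpow_lt_rpow_of_neg (by norm_num) (by norm_num) (by linarith)
  intro R hR x hx
  have hse := Real.sqrt_nonneg ε
  have hrR : r ≤ R := by linarith
  have hR0 : 0 < R := by linarith
  have hεR : ε ≤ R ^ 2 := by
    rw [← Real.sq_sqrt hε0.le]
    exact pow_le_pow_left₀ hse (by linarith) 2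
  have hcomp : ∀ y, ‖y - x0‖ ≤ 2 * R →
      M * (q y) ^ (-A) - u y ≤ M * ((2 * R) ^ 2 + ε) ^ (-A) := by
    set v := fun y => M * (q y) ^ (-A) - u y with hv
    have cv : ContDiff ℝ 2 v := (contDiff_const.mul (cpow _)).sub hu
    obtain ⟨y, hy, hmax⟩ := (isCompact_closedBall x0 (2 * R)).exists_isMaxOn
      ⟨x0, Metric.mem_closedBall_self (by linarith)⟩ cv.continuous.continuousOn
    have hyR : ‖y - x0‖ ≤ 2 * R := by rwa [mem_closedBall_iff_norm] at hy
    have hrhs : 0 ≤ M * ((2 * R) ^ 2 + ε) ^ (-A) := by positivity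
    have hvy : v y ≤ M * ((2 * R) ^ 2 + ε) ^ (-A) := by
      by_cases h1 : ‖y - x0‖ ≤ r
      · have := hball y h1
        have := hbM y
        simp only [hv]; linarith
      by_cases h2 : ‖y - x0‖ = 2 * R
      · have e : q y = (2 * R) ^ 2 + ε := by simp only [hq, h2]
        simp only [hv, e]
        linarith [hnn y]
      exfalso
      push Not at h1
      have hlt : ‖y - x0‖ < 2 * R := lt_of_le_of_ne hyR h2
      have hloc : IsLocalMax v y := by
        refine hmax.isLocalMax (Metric.closedBall_mem_nhds_of_mem ?_)
        rwa [mem_ball_iff_norm]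
      have hle := Finset.sum_nonpos (s := Finset.univ) fun i _ => pD_pD_nonpos_of_max i cv hloc
      have e : ∀ i, pD i (pD i v) y = M * pD i (pD i (fun x => (q x) ^ (-A))) y - pD i (pD i u) y := by
        intro i
        have d1 := (pD_contDiff i (cpow (-A)) (m := 1) (by norm_num)).differentiable (by norm_num)
        have d2 := (pD_contDiff i hu (m := 1) (by norm_num)).differentiable (by norm_num)
        rw [hv, pD_sub i ((dpow _).const_mul _) (hu.differentiable (by norm_num)),
          pD_const_mul i _ (dpow _), pD_sub i (d1.const_mul _) d2, pD_const_mul i _ d1]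
      simp only [e, Finset.sum_sub_distrib, ← Finset.mul_sum] at hle
      rw [hlap] at hle
      have hs := hsup y
      have hpos : 0 < M * (2 * A * (q y) ^ (-A - 2) * ((α + 2 - d) * q y - (α + 2) * ε)) := by
        have h3 : 0 < (q y) ^ (-A - 2) := Real.rpow_pos_of_pos (hqpos y) _
        have h4 : 0 < (α + 2 - d) * q y - (α + 2) * ε := by
          rw [hεr, ← mul_sub]
          apply mul_pos (by linarith)
          simp only [hq]; nlinarith
        positivity
      linarith
    intro z hz
    exact (hmax (by rwa [mem_closedBall_iff_norm])).trans hvy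
  have h1 := hcomp x (by linarith)
  have h2 : (2 * R ^ 2) ^ (-A) ≤ (q x) ^ (-A) := by
    apply Real.rpow_le_rpow_of_nonpos (hqpos x) _ (by linarith)
    simp only [hq]
    have := norm_nonneg (x - x0)
    nlinarith
  have h3 : ((2 * R) ^ 2 + ε) ^ (-A) ≤ (4 * R ^ 2) ^ (-A) := by
    apply Real.rpow_le_rpow_of_nonpos (by positivity) _ (by linarith)
    nlinarith
  rw [Real.mul_rpow (by norm_num) (by positivity)] at h2 h3
  have h4 := mul_le_mul_of_nonneg_left h2 hM0.le
  have h5 := mul_le_mul_of_nonneg_left h3 hM0.le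
  nlinarith

lemma ode_contra {φ φ' φ'' : ℝ → ℝ} (k : ℝ) (hk : 0 < k) (h1 : ∀ t, HasDerivAt φ (φ' t) t)
    (h2 : ∀ t, HasDerivAt φ' (φ'' t) t) (h : ∀ t, φ' t ^ 2 / k ≤ φ'' t) : φ' 0 ≤ 0 := by
  by_contra! hpos
  set g := fun t => exp (-(φ t / k)) with hg
  have gpos : ∀ t, 0 < g t := fun t => exp_pos _
  have g1 : ∀ t, HasDerivAt g (g t * -(φ' t / k)) t := fun t =>
    (((h1 t).div_const k).fun_neg).exp
  have g2 : ∀ t, HasDerivAt (fun t => g t * -(φ' t / k))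
      ((g t * -(φ' t / k)) * -(φ' t / k) + g t * -(φ'' t / k)) t := fun t =>
    (g1 t).fun_mul (((h2 t).div_const k).fun_neg)
  have anti : Antitone (fun t => g t * -(φ' t / k)) := by
    apply antitone_of_deriv_nonpos (fun t => (g2 t).differentiableAt)
    intro t
    rw [(g2 t).deriv]
    have : (g t * -(φ' t / k)) * -(φ' t / k) + g t * -(φ'' t / k)
      = -(g t / k) * (φ'' t - φ' t ^ 2 / k) := by field_simp; ring
    rw [this]
    have h3 : 0 ≤ g t / k := div_nonneg (gpos t).le hk.le
    have h4 := h t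
    nlinarith
  set s := g 0 * -(φ' 0 / k) with hs
  have hs0 : s < 0 := by
    have : 0 < φ' 0 / k := by positivity
    have := gpos 0
    rw [hs]; nlinarith
  have d3 : ∀ t, HasDerivAt (fun t => g t - s * t) (g t * -(φ' t / k) - s) t := by
    intro t
    simpa using (g1 t).fun_sub ((hasDerivAt_id t).const_mul s)
  have an : AntitoneOn (fun t => g t - s * t) (Set.Ici 0) := by
    apply antitoneOn_of_deriv_nonpos (convex_Ici 0)
    · exact fun t _ => (d3 t).continuousAt.continuousWithinAt
    · exact fun t _ => (d3 t).differentiableAt.differentiableWithinAt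
    · intro t ht
      rw [interior_Ici, Set.mem_Ioi] at ht
      rw [(d3 t).deriv]
      have := anti ht.le
      simp only at this
      linarith
  have hT : 0 ≤ g 0 / (-s) := div_nonneg (gpos 0).le (by linarith)
  have := an (Set.mem_Ici.2 le_rfl) (Set.mem_Ici.2 hT) hT
  simp only at this
  have e : s * (g 0 / (-s)) = - g 0 := by
    have : s ≠ 0 := hs0.ne
    field_simp
  have := gpos (g 0 / (-s))
  linarith

lemma weight_const {d : ℕ} (k : ℝ) (hk : 0 < k)
    (f : EuclideanSpace ℝ (Fin d) → ℝ) (hf : ContDiff ℝ 2 f)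
    (hBE : ∀ x ξ : EuclideanSpace ℝ (Fin d),
      ⟪gradient f x, ξ⟫ ^ 2 / k ≤ iteratedFDeriv ℝ 2 f x ![ξ, ξ])
    (x : EuclideanSpace ℝ (Fin d)) : gradient f x = 0 := by
  have df : Differentiable ℝ f := hf.differentiable (by norm_num)
  have df1 : Differentiable ℝ (fderiv ℝ f) :=
    (hf.fderiv_right (m := 1) (by norm_num)).differentiable (by norm_num)
  have hgr : ∀ y v, ⟪gradient f y, v⟫ = fderiv ℝ f y v := by
    intro y v; unfold gradient; simp
  have key : ∀ v, fderiv ℝ f x v ≤ 0 := by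
    intro v
    have hl : ∀ t : ℝ, HasDerivAt (fun t : ℝ => x + t • v) v t := by
      intro t
      simpa using ((hasDerivAt_id t).smul_const v).const_add x
    have a1 : ∀ t : ℝ, HasDerivAt (fun t : ℝ => f (x + t • v)) (fderiv ℝ f (x + t • v) v) t :=
      fun t => (df _).hasFDerivAt.comp_hasDerivAt t (hl t)
    have a2 : ∀ t : ℝ, HasDerivAt (fun t : ℝ => fderiv ℝ f (x + t • v) v)
        (fderiv ℝ (fderiv ℝ f) (x + t • v) v v) t := by
      intro t
      have b1 : HasDerivAt (fun t : ℝ => fderiv ℝ f (x + t • v))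
          (fderiv ℝ (fderiv ℝ f) (x + t • v) v) t :=
        (df1 (x + t • v)).hasFDerivAt.comp_hasDerivAt t (hl t)
      have b2 := b1.clm_apply (hasDerivAt_const t v)
      rw [map_zero, add_zero] at b2
      exact b2
    have a3 : ∀ t : ℝ, (fderiv ℝ f (x + t • v) v) ^ 2 / k ≤
        fderiv ℝ (fderiv ℝ f) (x + t • v) v v := by
      intro t
      have b := hBE (x + t • v) v
      rw [iteratedFDeriv_two_apply, hgr] at b
      exact b
    have b := ode_contra k hk a1 a2 a3
    rw [zero_smul, add_zero] at b
    exact b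
  have hz : fderiv ℝ f x = 0 := by
    ext v
    have h1 := key v
    have h2 := key (-v)
    simp at h2
    simpa using le_antisymm h1 h2
  unfold gradient; rw [hz]; simp

/-- Euclidean-base instance of Theorem 2.6: Liouville theorem for the Lane-Emden
equation subcritical with respect to the virtual dimension n, under Ric_{n,d} ≥ 0
(on flat ℝ^d: Hess f[ξ,ξ] ≥ (∇f·ξ)²/(n−d)). -/
theorem subcritical_laneEmden_liouville_virtualDim
    (d : ℕ) (hd : 2 ≤ d) (n : ℝ) (hn : (d : ℝ) < n)
    (f : EuclideanSpace ℝ (Fin d) → ℝ) (hf : ContDiff ℝ 2 f)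
    (hBE : ∀ x ξ : EuclideanSpace ℝ (Fin d),
      ⟪gradient f x, ξ⟫ ^ 2 / (n - (d : ℝ)) ≤ iteratedFDeriv ℝ 2 f x ![ξ, ξ])
    (p : ℝ) (hp : 1 < p) (hps : (n - 2) * p < n + 2)
    (u : EuclideanSpace ℝ (Fin d) → ℝ)
    (hu : ContDiff ℝ 3 u) (hunneg : ∀ x, 0 ≤ u x)
    (heq : ∀ x, lapl u x - ⟪gradient f x, gradient u x⟫ + u x ^ p = 0) :
    ∀ x, u x = 0 := by
  classical
  by_contra hcon
  push Not at hcon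
  obtain ⟨x0, hx0⟩ := hcon
  have hx0 : 0 < u x0 := lt_of_le_of_ne (hunneg x0) (Ne.symm hx0)
  have hd2 : (2 : ℝ) ≤ d := by exact_mod_cast hd
  have hn2 : 2 < n := by linarith
  have hu2 : ContDiff ℝ 2 u := hu.of_le (by norm_num)
  have hlap : ∀ x, ∑ i, pD i (pD i u) x = -(u x ^ p) := by
    intro x
    have h1 := heq x
    rw [weight_const (n - d) (by linarith) f hf hBE x, inner_zero_left, lapl_eq u hu2] at h1
    linarith
  have hsup : ∀ x, ∑ i, pD i (pD i u) x ≤ 0 := by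
    intro x
    rw [hlap]
    have := Real.rpow_nonneg (hunneg x) p
    linarith
  obtain ⟨m, R0, hm, hR0, hlow⟩ := lower_bound hu2 hunneg hsup (n - 2) (by linarith)
    (by linarith) x0 hx0
  have hupos : ∀ x, 0 < u x := by
    intro x
    have h1 := hlow (max R0 ‖x - x0‖) (le_max_left _ _) x (le_max_right _ _)
    have h2 : 0 < max R0 ‖x - x0‖ := lt_max_of_lt_left hR0
    refine lt_of_lt_of_le ?_ h1
    positivity
  set w := fun x => Real.log (u x) with hw
  have cw : ContDiff ℝ 3 w := hu.log fun x => (hupos x).ne'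
  have hexp : ∀ x, exp (w x) = u x := fun x => Real.exp_log (hupos x)
  have dw : Differentiable ℝ w := cw.differentiable (by norm_num)
  have hweq : ∀ x, ∑ i, pD i (pD i w) x =
      -(∑ j, pD j w x * pD j w x) - exp ((p - 1) * w x) := by
    intro x
    have hue : u = fun x => exp (w x) := by ext y; rw [hexp]
    have h1 : ∀ i, pD i (pD i u) x = u x * (pD i w x * pD i w x) + u x * pD i (pD i w) x := by
      intro i
      have dw1 : Differentiable ℝ (pD i w) :=
        (pD_contDiff i cw (m := 2) (by norm_num)).differentiable (by norm_num)
      have e1 : pD i u = fun x => exp (w x) * pD i w x := by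
        conv_lhs => rw [hue]
        exact pD_exp i dw
      rw [e1, pD_mul i (by fun_prop) dw1, pD_exp i dw]
      simp only [hexp]
      ring
    have h2 := hlap x
    simp only [h1, Finset.sum_add_distrib, ← Finset.mul_sum] at h2
    have h3 : u x ^ p = u x * exp ((p - 1) * w x) := by
      rw [Real.rpow_def_of_pos (hupos x)]
      nth_rewrite 2 [← hexp x]
      rw [← Real.exp_add]
      congr 1
      simp only [hw]; ring
    rw [h3] at h2
    have h4 : u x * (∑ i, pD i (pD i w) x) =
        u x * (-(∑ j, pD j w x * pD j w x) - exp ((p - 1) * w x)) := by linarith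
    exact mul_left_cancel₀ (hupos x).ne' h4
  obtain ⟨β, a, κ, c, hβ, hβ2, ha, hc, hE⟩ := params n p hn2 hp hps
  obtain ⟨C, hC0, hC⟩ := max_est cw n p β a κ c (by linarith) hn.le ha hc hE hweq
  set Z := exp (-β * w x0) * ((∑ j, pD j w x0 * pD j w x0) + a * exp ((p - 1) * w x0)) with hZ
  have hZ0 : 0 < Z := by
    have h1 : 0 ≤ ∑ j, pD j w x0 * pD j w x0 := Finset.sum_nonneg fun j _ => mul_self_nonneg _
    have h2 := exp_pos ((p - 1) * w x0)
    have h3 := exp_pos (-β * w x0)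
    rw [hZ]
    positivity
  set γ := 1 - (n - 2) / 2 * β with hγ
  have hγ0 : 0 < γ := by rw [hγ]; linarith
  have hfin : ∀ R, R0 ≤ R → (R ^ 2) ^ γ * Z ≤ C * m ^ (-β) := by
    intro R hR
    have hRp : 0 < R := by linarith
    obtain ⟨x1, hx1, hle⟩ := hC x0 R hRp
    have h1 := hlow R hR x1 hx1
    have h2 : exp (-β * w x1) = (u x1) ^ (-β) := by
      rw [Real.rpow_def_of_pos (hupos x1)]
      congr 1
      simp only [hw]; ring
    have hmp : 0 < m * (R ^ 2) ^ (-((n - 2) / 2)) := by positivity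
    have h3 : (u x1) ^ (-β) ≤ (m * (R ^ 2) ^ (-((n - 2) / 2))) ^ (-β) :=
      Real.rpow_le_rpow_of_nonpos hmp h1 (by linarith)
    rw [Real.mul_rpow hm.le (by positivity), ← Real.rpow_mul (by positivity)] at h3
    have h4 : -((n - 2) / 2) * -β = 1 - γ := by rw [hγ]; ring
    rw [h4] at h3
    rw [h2] at hle
    have h5 : R ^ 4 * Z ≤ C * R ^ 2 * (m ^ (-β) * (R ^ 2) ^ (1 - γ)) :=
      hle.trans (mul_le_mul_of_nonneg_left h3 (by positivity))
    have h6 : (R ^ 2) ^ γ * (R ^ 2) ^ (1 - γ) = R ^ 2 := by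
      rw [← Real.rpow_add (by positivity)]; simp
    have h7 : 0 < (R ^ 2) ^ (1 - γ) := by positivity
    have h8 : 0 < R ^ 2 := by positivity
    have h9 : ((R ^ 2) ^ γ * Z) * (R ^ 2 * (R ^ 2) ^ (1 - γ)) ≤
        (C * m ^ (-β)) * (R ^ 2 * (R ^ 2) ^ (1 - γ)) := by
      calc _ = R ^ 2 * ((R ^ 2) ^ γ * (R ^ 2) ^ (1 - γ)) * Z := by ring
        _ = R ^ 4 * Z := by rw [h6]; ring
        _ ≤ _ := h5
        _ = _ := by ring
    exact le_of_mul_le_mul_right h9 (by positivity)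
  have htend : Tendsto (fun R : ℝ => (R ^ 2) ^ γ * Z) atTop atTop :=
    ((tendsto_rpow_atTop hγ0).comp (tendsto_pow_atTop (by norm_num))).atTop_mul_const hZ0
  obtain ⟨R, hR1, hR2⟩ := ((htend.eventually_gt_atTop (C * m ^ (-β))).and
    (eventually_ge_atTop R0)).exists
  linarith [hfin R hR2]
end

section
/- Let f : ℝ² → ℝ be C² and convex, and let u : ℝ² → ℝ be a C³ function satisfying Δu − ∇f·∇u + e^u = 0 on all of ℝ², such that ∇f(x)·∇u(x) ≤ 0 for every x ∈ ℝ². Assume there exist o ∈ ℝ² and C > 0 such that ∫_{B_R(o)} e^{−f(x)} dx ≤ C·R² for all R ≥ 1. Let R* > 0 and let G : [R*, ∞) → (0, ∞) be nondecreasing with ∫_{R*}^∞ dt/(t·G(t)) = +∞, and assume u(x) ≥ −4·log(|x−o|·G(|x−o|)^{1/2}) for all x with |x−o| ≥ R*. Then f is constant on ℝ², and there exist a, b > 0 with 8ab = 1 and x₀ ∈ ℝ² such that u(x) = log(1/(a + b·|x−x₀|²)²) for all x. [Euclidean-base instance of Theorem 2.7.] -/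
open Real MeasureTheory Filter
open scoped RealInnerProductSpace

abbrev E2 := EuclideanSpace ℝ (Fin 2)

/-- partial derivative -/
noncomputable def pd (i : Fin 2) (w : E2 → ℝ) (x : E2) : ℝ :=
  fderiv ℝ w x (EuclideanSpace.single i 1)

lemma pd_contDiff {n m : WithTop ℕ∞} {w : E2 → ℝ} (hw : ContDiff ℝ n w) (h : m + 1 ≤ n)
    (i : Fin 2) : ContDiff ℝ m (pd i w) := by
  unfold pd
  exact (hw.fderiv_right h).clm_apply contDiff_const

lemma pd_add {w z : E2 → ℝ} {x : E2} (hw : DifferentiableAt ℝ w x) (hz : DifferentiableAt ℝ z x)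
    (i : Fin 2) : pd i (fun y => w y + z y) x = pd i w x + pd i z x := by
  unfold pd
  rw [fderiv_fun_add hw hz]; rfl

lemma pd_sub {w z : E2 → ℝ} {x : E2} (hw : DifferentiableAt ℝ w x) (hz : DifferentiableAt ℝ z x)
    (i : Fin 2) : pd i (fun y => w y - z y) x = pd i w x - pd i z x := by
  unfold pd
  rw [fderiv_fun_sub hw hz]; rfl

lemma pd_mul {w z : E2 → ℝ} {x : E2} (hw : DifferentiableAt ℝ w x) (hz : DifferentiableAt ℝ z x)
    (i : Fin 2) : pd i (fun y => w y * z y) x = pd i w x * z x + w x * pd i z x := by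
  unfold pd
  rw [fderiv_fun_mul hw hz]
  simp; ring

lemma pd_const (c : ℝ) (x : E2) (i : Fin 2) : pd i (fun _ => c) x = 0 := by
  unfold pd; simp

lemma pd_exp {w : E2 → ℝ} {x : E2} (hw : DifferentiableAt ℝ w x)
    (i : Fin 2) : pd i (fun y => Real.exp (w y)) x = Real.exp (w x) * pd i w x := by
  unfold pd
  rw [fderiv_exp hw]; simp

lemma pd_snd {w : E2 → ℝ} (hw : ContDiff ℝ 2 w) (x : E2) (i j : Fin 2) :
    pd i (pd j w) x = fderiv ℝ (fderiv ℝ w) x (EuclideanSpace.single i 1)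
      (EuclideanSpace.single j 1) := by
  unfold pd
  have h1 : DifferentiableAt ℝ (fderiv ℝ w) x :=
    ((hw.fderiv_right (m := 1) (by norm_num)).differentiable (by norm_num)) x
  rw [fderiv_clm_apply h1 (by fun_prop)]
  simp

lemma pd_comm {w : E2 → ℝ} (hw : ContDiff ℝ 2 w) (x : E2) (i j : Fin 2) :
    pd i (pd j w) x = pd j (pd i w) x := by
  rw [pd_snd hw, pd_snd hw]
  exact (hw.contDiffAt.isSymmSndFDerivAt (by simp)) _ _

lemma lapl_eq_s6 {w : E2 → ℝ} (hw : ContDiff ℝ 2 w) (x : E2) :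
    lapl w x = pd 0 (pd 0 w) x + pd 1 (pd 1 w) x := by
  unfold lapl
  rw [Fin.sum_univ_two, iteratedFDeriv_two_apply, iteratedFDeriv_two_apply, pd_snd hw, pd_snd hw]
  simp

lemma vec_eq (y : E2) : y = y 0 • EuclideanSpace.single 0 1 + y 1 • EuclideanSpace.single 1 1 := by
  ext i; fin_cases i <;> simp

lemma fderiv_eq_pd (w : E2 → ℝ) (x y : E2) :
    fderiv ℝ w x y = y 0 * pd 0 w x + y 1 * pd 1 w x := by
  conv_lhs => rw [vec_eq y]
  simp [pd]

lemma inner_grad (w z : E2 → ℝ) (x : E2) :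
    ⟪gradient w x, gradient z x⟫ = pd 0 w x * pd 0 z x + pd 1 w x * pd 1 z x := by
  have h : ∀ i : Fin 2, (gradient z x) i = pd i z x := by
    intro i
    have := inner_gradient_left (𝕜 := ℝ) (f := z) (x := x) (y := EuclideanSpace.single i (1:ℝ))
    rw [EuclideanSpace.inner_single_right] at this
    simpa [pd] using this
  rw [inner_gradient_left, fderiv_eq_pd, h, h]; ring

lemma hess_nonneg {f : E2 → ℝ} (hf : ContDiff ℝ 2 f) (hconv : ConvexOn ℝ Set.univ f)
    (x : E2) (a b : ℝ) :
    0 ≤ a ^ 2 * pd 0 (pd 0 f) x + 2 * a * b * pd 0 (pd 1 f) x + b ^ 2 * pd 1 (pd 1 f) x := by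
  set w : E2 := a • EuclideanSpace.single 0 1 + b • EuclideanSpace.single 1 1 with hw
  have hl : ∀ t : ℝ, HasDerivAt (fun t : ℝ => x + t • w) w t := by
    intro t
    simpa using ((hasDerivAt_id t).smul_const w).const_add x
  have hd : Differentiable ℝ f := hf.differentiable (by norm_num)
  have hd' : Differentiable ℝ (fderiv ℝ f) :=
    (hf.fderiv_right (m := 1) (by norm_num)).differentiable (by norm_num)
  have h1 : ∀ t : ℝ, HasDerivAt (fun t : ℝ => f (x + t • w)) (fderiv ℝ f (x + t • w) w) t := by
    intro t
    exact (hd (x + t • w)).hasFDerivAt.comp_hasDerivAt t (hl t)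
  have hc : ConvexOn ℝ Set.univ (fun t : ℝ => f (x + t • w)) := by
    refine ⟨convex_univ, ?_⟩
    intro s _ t _ p q hp hq hpq
    have := hconv.2 (Set.mem_univ (x + s • w)) (Set.mem_univ (x + t • w)) hp hq hpq
    convert this using 2
    have : x = (p + q) • x := by rw [hpq, one_smul]
    conv_lhs => rw [this]
    simp only [smul_add, smul_smul, add_smul, smul_eq_mul]
    abel
  have hm : Monotone (fun t : ℝ => fderiv ℝ f (x + t • w) w) := by
    have := hc.monotoneOn_deriv (fun t _ => (h1 t).differentiableAt)
    have e : deriv (fun t : ℝ => f (x + t • w)) = fun t : ℝ => fderiv ℝ f (x + t • w) w :=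
      funext fun t => (h1 t).deriv
    rw [e] at this
    exact monotoneOn_univ.1 this
  have h2 : HasDerivAt (fun t : ℝ => fderiv ℝ f (x + t • w) w)
      (fderiv ℝ (fderiv ℝ f) x w w) 0 := by
    have := (hd' (x + (0:ℝ) • w)).hasFDerivAt.comp_hasDerivAt 0 (hl 0)
    have := this.clm_apply (hasDerivAt_const (0:ℝ) w)
    simpa using this
  have h3 : 0 ≤ fderiv ℝ (fderiv ℝ f) x w w := by
    rw [← h2.deriv]; exact hm.deriv_nonneg
  have h4 := pd_comm hf x 0 1
  rw [pd_snd hf, pd_snd hf] at h4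
  rw [pd_snd hf, pd_snd hf, pd_snd hf]
  have : fderiv ℝ (fderiv ℝ f) x w w = a ^ 2 * fderiv ℝ (fderiv ℝ f) x (EuclideanSpace.single 0 1)
      (EuclideanSpace.single 0 1) + 2 * a * b * fderiv ℝ (fderiv ℝ f) x (EuclideanSpace.single 0 1)
      (EuclideanSpace.single 1 1) + b ^ 2 * fderiv ℝ (fderiv ℝ f) x (EuclideanSpace.single 1 1)
      (EuclideanSpace.single 1 1) := by
    rw [hw]
    simp only [map_add, map_smul, _root_.add_apply, _root_.smul_apply,
      smul_eq_mul, ← h4]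
    ring
  linarith

/-- the P-function -/
noncomputable def Pf (v : E2 → ℝ) (x : E2) : ℝ :=
  (pd 0 v x ^ 2 + pd 1 v x ^ 2 + 1 / 2) / v x

/-- weighted Laplacian -/
noncomputable def wL (f w : E2 → ℝ) (x : E2) : ℝ :=
  pd 0 (pd 0 w) x + pd 1 (pd 1 w) x - (pd 0 f x * pd 0 w x + pd 1 f x * pd 1 w x)

lemma Pf_contDiff {v : E2 → ℝ} (hv : ContDiff ℝ 3 v) (hpos : ∀ x, 0 < v x) :
    ContDiff ℝ 2 (Pf v) := by
  unfold Pf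
  have h0 : ContDiff ℝ 2 (pd 0 v) := pd_contDiff hv (by norm_num) 0
  have h1 : ContDiff ℝ 2 (pd 1 v) := pd_contDiff hv (by norm_num) 1
  exact (((h0.pow 2).add (h1.pow 2)).add contDiff_const).div (hv.of_le (by norm_num))
    (fun x => (hpos x).ne')

lemma Pf_pos {v : E2 → ℝ} (hpos : ∀ x, 0 < v x) (x : E2) : 0 < Pf v x := by
  unfold Pf
  have := hpos x
  positivity

/-- Bochner-type computation: gradient of P and `v * L P`. -/
lemma bochner_s6 {f v : E2 → ℝ} (hf : ContDiff ℝ 2 f) (hv : ContDiff ℝ 3 v) (hpos : ∀ x, 0 < v x)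
    (heq : ∀ x, wL f v x = Pf v x) (x : E2) :
    (∀ j, pd j (Pf v) x * v x + Pf v x * pd j v x =
      2 * (pd 0 v x * pd j (pd 0 v) x + pd 1 v x * pd j (pd 1 v) x)) ∧
    v x * wL f (Pf v) x = 
      2 * (pd 0 (pd 0 v) x ^ 2 + 2 * pd 0 (pd 1 v) x ^ 2 + pd 1 (pd 1 v) x ^ 2) - Pf v x ^ 2
      + 2 * (pd 0 v x ^ 2 * pd 0 (pd 0 f) x + 2 * pd 0 v x * pd 1 v x * pd 0 (pd 1 f) x
        + pd 1 v x ^ 2 * pd 1 (pd 1 f) x) := by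
  have hP := Pf_contDiff hv hpos
  have hv2 : ContDiff ℝ 2 v := hv.of_le (by norm_num)
  have dv : Differentiable ℝ v := hv.differentiable (by norm_num)
  have dP : Differentiable ℝ (Pf v) := hP.differentiable (by norm_num)
  have c1 : ∀ i, ContDiff ℝ 2 (pd i v) := fun i => pd_contDiff hv (by norm_num) i
  have d1 : ∀ i, Differentiable ℝ (pd i v) := fun i => (c1 i).differentiable (by norm_num)
  have d2 : ∀ i j, Differentiable ℝ (pd i (pd j v)) := fun i j =>
    (pd_contDiff (m := 1) (c1 j) (by norm_num) i).differentiable (by norm_num)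
  have dP1 : ∀ i, Differentiable ℝ (pd i (Pf v)) := fun i =>
    (pd_contDiff (m := 1) hP (by norm_num) i).differentiable (by norm_num)
  have df1 : ∀ i, Differentiable ℝ (pd i f) := fun i =>
    (pd_contDiff (m := 1) hf (by norm_num) i).differentiable (by norm_num)
  have e0 : (fun y => Pf v y * v y) =
      fun y => pd 0 v y * pd 0 v y + pd 1 v y * pd 1 v y + 1 / 2 := by
    funext y
    unfold Pf
    have := (hpos y).ne'
    field_simp
  have e1 : ∀ j y, pd j (Pf v) y * v y + Pf v y * pd j v y =
      2 * (pd 0 v y * pd j (pd 0 v) y + pd 1 v y * pd j (pd 1 v) y) := by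
    intro j y
    have := congrArg (fun w => pd j w y) e0
    rw [pd_mul (dP y) (dv y), pd_add (((d1 0 y).fun_mul (d1 0 y)).fun_add ((d1 1 y).fun_mul (d1 1 y)))
      (differentiableAt_const _), pd_add ((d1 0 y).fun_mul (d1 0 y)) ((d1 1 y).fun_mul (d1 1 y)),
      pd_mul (d1 0 y) (d1 0 y), pd_mul (d1 1 y) (d1 1 y), pd_const] at this
    rw [this]; ring
  refine ⟨fun j => e1 j x, ?_⟩
  have e2 : ∀ j, pd j (pd j (Pf v)) x * v x + 2 * (pd j (Pf v) x * pd j v x)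
      + Pf v x * pd j (pd j v) x =
      2 * (pd j (pd 0 v) x ^ 2 + pd 0 v x * pd j (pd j (pd 0 v)) x +
        (pd j (pd 1 v) x ^ 2 + pd 1 v x * pd j (pd j (pd 1 v)) x)) := by
    intro j
    have := congrArg (fun w => pd j w x) (funext (e1 j))
    rw [pd_add ((dP1 j x).fun_mul (dv x)) ((dP x).fun_mul (d1 j x)), pd_mul (dP1 j x) (dv x),
      pd_mul (dP x) (d1 j x), pd_mul (differentiableAt_const _) (((d1 0 x).fun_mul (d2 j 0 x)).fun_add
      ((d1 1 x).fun_mul (d2 j 1 x))), pd_const, pd_add ((d1 0 x).fun_mul (d2 j 0 x))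
      ((d1 1 x).fun_mul (d2 j 1 x)), pd_mul (d1 0 x) (d2 j 0 x), pd_mul (d1 1 x) (d2 j 1 x)] at this
    linarith
  have e3 : ∀ j, pd j (Pf v) x = pd j (pd 0 (pd 0 v)) x + pd j (pd 1 (pd 1 v)) x -
      (pd j (pd 0 f) x * pd 0 v x + pd 0 f x * pd j (pd 0 v) x +
       (pd j (pd 1 f) x * pd 1 v x + pd 1 f x * pd j (pd 1 v) x)) := by
    intro j
    have := congrArg (fun w => pd j w x) (funext heq)
    have h' : pd j (fun y => Pf v y) x = pd j (Pf v) x := rfl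
    rw [← h', ← this]
    unfold wL
    rw [pd_sub ((d2 0 0 x).fun_add (d2 1 1 x)) (((df1 0 x).fun_mul (d1 0 x)).fun_add ((df1 1 x).fun_mul (d1 1 x))),
      pd_add (d2 0 0 x) (d2 1 1 x), pd_add ((df1 0 x).fun_mul (d1 0 x)) ((df1 1 x).fun_mul (d1 1 x)),
      pd_mul (df1 0 x) (d1 0 x), pd_mul (df1 1 x) (d1 1 x)]
  have s1 : ∀ y, pd 1 (pd 0 v) y = pd 0 (pd 1 v) y := fun y => pd_comm hv2 y 1 0
  have s2 : pd 1 (pd 0 f) x = pd 0 (pd 1 f) x := pd_comm hf x 1 0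
  have s1' : pd 1 (pd 0 v) = pd 0 (pd 1 v) := funext s1
  have t1 : pd 1 (pd 1 (pd 0 v)) x = pd 0 (pd 1 (pd 1 v)) x := by
    rw [s1', pd_comm (c1 1)]
  have t2 : pd 1 (pd 0 (pd 0 v)) x = pd 0 (pd 0 (pd 1 v)) x := by
    rw [pd_comm (c1 0), s1']
  have a0 := e1 0 x
  have a1 := e1 1 x
  have b0 := e2 0
  have b1 := e2 1
  have g0 := e3 0
  have g1 := e3 1
  have hh := heq x
  rw [t1] at b1
  rw [t2] at g1
  rw [s1] at a1 b1 g1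
  rw [s2] at g1
  unfold wL at hh ⊢
  linear_combination b0 + b1 - pd 0 f x * a0 - pd 1 f x * a1 - 2 * pd 0 v x * g0
    - 2 * pd 1 v x * g1 - Pf v x * hh

/-- The key differential inequality and the rigidity in the equality case. -/
lemma key {f v : E2 → ℝ} (hf : ContDiff ℝ 2 f) (hconv : ConvexOn ℝ Set.univ f)
    (hv : ContDiff ℝ 3 v) (hpos : ∀ x, 0 < v x)
    (heq : ∀ x, wL f v x = Pf v x)
    (hD : ∀ x, 0 ≤ pd 0 f x * pd 0 v x + pd 1 f x * pd 1 v x) (x : E2) :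
    pd 0 (Pf v) x ^ 2 + pd 1 (Pf v) x ^ 2 ≤ 2 * Pf v x * wL f (Pf v) x ∧
    0 ≤ wL f (Pf v) x ∧
    (wL f (Pf v) x = 0 → pd 0 f x * pd 0 v x + pd 1 f x * pd 1 v x = 0 ∧
      pd 0 (pd 1 v) x = 0 ∧ pd 0 (pd 0 v) x = Pf v x / 2 ∧ pd 1 (pd 1 v) x = Pf v x / 2) := by
  obtain ⟨h1, h2⟩ := bochner_s6 hf hv hpos heq x
  have h10 := h1 0
  have h11 := h1 1
  have hs := pd_comm (hv.of_le (by norm_num)) x 1 0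
  rw [hs] at h11
  have hH := hess_nonneg hf hconv x (pd 0 v x) (pd 1 v x)
  have hP := Pf_pos hpos x
  have hh := heq x
  have hPv : Pf v x * v x = pd 0 v x ^ 2 + pd 1 v x ^ 2 + 1 / 2 := by
    unfold Pf
    have := (hpos x).ne'
    field_simp
  have hD := hD x
  have hvx := hpos x
  rw [wL] at hh
  clear h1 heq hs
  generalize wL f (Pf v) x = S at *
  generalize Pf v x = P at *
  generalize v x = V at *
  generalize pd 0 (Pf v) x = P0 at *
  generalize pd 1 (Pf v) x = P1 at *
  generalize pd 0 (pd 0 v) x = v00 at *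
  generalize pd 0 (pd 1 v) x = v01 at *
  generalize pd 1 (pd 1 v) x = v11 at *
  generalize pd 0 v x = v0 at *
  generalize pd 1 v x = v1 at *
  generalize (pd 0 f x * v0 + pd 1 f x * v1) = D at *
  generalize (v0 ^ 2 * pd 0 (pd 0 f) x + 2 * v0 * v1 * pd 0 (pd 1 f) x + v1 ^ 2 * pd 1 (pd 1 f) x)
    = H at *
  have e11 : v11 = P + D - v00 := by linarith
  have hVS : V * S = (v00 - v11) ^ 2 + 4 * v01 ^ 2 + D ^ 2 + 2 * P * D + 2 * H := by
    rw [h2, e11]; ring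
  have hPD : 0 ≤ P * D := by positivity
  have hS : 0 ≤ S := by
    have : 0 ≤ V * S := by rw [hVS]; positivity
    exact nonneg_of_mul_nonneg_right this hvx
  refine ⟨?_, hS, ?_⟩
  · set X0 := (v00 - v11) * v0 + 2 * v01 * v1 with hX0
    set X1 := 2 * v01 * v0 - (v00 - v11) * v1 with hX1
    have q0 : P0 * V = X0 + D * v0 := by rw [hX0, e11]; linear_combination h10
    have q1 : P1 * V = X1 + D * v1 := by rw [hX1]; rw [e11] at h11 ⊢; linear_combination h11
    have hX : X0 ^ 2 + X1 ^ 2 = ((v00 - v11) ^ 2 + 4 * v01 ^ 2) * (v0 ^ 2 + v1 ^ 2) := by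
      rw [hX0, hX1]; ring
    have h5 : V ^ 2 * (P0 ^ 2 + P1 ^ 2) ≤ V ^ 2 * (2 * P * S) := by
      calc V ^ 2 * (P0 ^ 2 + P1 ^ 2) = (X0 + D * v0) ^ 2 + (X1 + D * v1) ^ 2 := by
            rw [← q0, ← q1]; ring
        _ ≤ 2 * (X0 ^ 2 + X1 ^ 2) + 2 * D ^ 2 * (v0 ^ 2 + v1 ^ 2) := by
            nlinarith [sq_nonneg (X0 - D * v0), sq_nonneg (X1 - D * v1)]
        _ = 2 * (v0 ^ 2 + v1 ^ 2) * ((v00 - v11) ^ 2 + 4 * v01 ^ 2 + D ^ 2) := by rw [hX]; ring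
        _ ≤ 2 * (v0 ^ 2 + v1 ^ 2) * (V * S) := by
            rw [hVS]
            apply mul_le_mul_of_nonneg_left _ (by positivity)
            linarith
        _ ≤ 2 * (P * V) * (V * S) := by
            rw [hPv]
            apply mul_le_mul_of_nonneg_right _ (by positivity)
            linarith
        _ = _ := by ring
    exact le_of_mul_le_mul_left h5 (by positivity)
  · intro h0
    rw [h0, mul_zero] at hVS
    have z1 : D = 0 := by
      have : D ^ 2 = 0 := by nlinarith [sq_nonneg (v00 - v11), sq_nonneg v01, sq_nonneg D]
      exact pow_eq_zero_iff (two_ne_zero) |>.1 this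
    have z2 : v01 = 0 := by
      have : v01 ^ 2 = 0 := by nlinarith [sq_nonneg (v00 - v11), sq_nonneg v01, sq_nonneg D]
      exact pow_eq_zero_iff (two_ne_zero) |>.1 this
    have z3 : v00 - v11 = 0 := by
      have : (v00 - v11) ^ 2 = 0 := by
        nlinarith [sq_nonneg (v00 - v11), sq_nonneg v01, sq_nonneg D]
      exact pow_eq_zero_iff (two_ne_zero) |>.1 this
    exact ⟨z1, z2, by linarith, by linarith⟩

lemma ibp {f w η : E2 → ℝ} (hf : ContDiff ℝ 2 f) (hw : ContDiff ℝ 2 w) (hη : ContDiff ℝ 1 η)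
    (hc : HasCompactSupport η) :
    ∫ x, η x * (Real.exp (-f x) * wL f w x) =
      -∫ x, Real.exp (-f x) * (pd 0 η x * pd 0 w x + pd 1 η x * pd 1 w x) := by
  have cη : ∀ i, Continuous (pd i η) := fun i =>
    (pd_contDiff (m := 0) hη (by norm_num) i).continuous
  have sη : ∀ i, HasCompactSupport (pd i η) := fun i => by
    have := (hc.fderiv ℝ)
    exact this.comp_left (g := fun L : E2 →L[ℝ] ℝ => L (EuclideanSpace.single i 1)) (by simp)
  have cw : ∀ i, ContDiff ℝ 1 (pd i w) := fun i => pd_contDiff hw (by norm_num) i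
  have hf1 : ContDiff ℝ 1 f := hf.of_le (by norm_num)
  have cg : ∀ i, ContDiff ℝ 1 (fun y => Real.exp (-f y) * pd i w y) := fun i =>
    (hf1.neg.exp).mul (cw i)
  have df : Differentiable ℝ f := hf1.differentiable (by norm_num)
  have dg : ∀ i x, pd i (fun y => Real.exp (-f y) * pd i w y) x =
      Real.exp (-f x) * (pd i (pd i w) x - pd i f x * pd i w x) := by
    intro i x
    have d1 : DifferentiableAt ℝ (fun y => Real.exp (-f y)) x := (df x).neg.exp
    have d2 : DifferentiableAt ℝ (pd i w) x := (cw i).differentiable (by norm_num) x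
    rw [pd_mul d1 d2, pd_exp (df x).fun_neg]
    have : pd i (fun y => -f y) x = - pd i f x := by
      unfold pd; rw [fderiv_fun_neg]; rfl
    rw [this]
    ring
  have cdg : ∀ i, Continuous (pd i (fun y => Real.exp (-f y) * pd i w y)) := fun i =>
    (pd_contDiff (m := 0) (cg i) (by norm_num) i).continuous
  have I1 : ∀ i, Integrable (fun x => pd i η x * (Real.exp (-f x) * pd i w x)) := fun i =>
    ((cη i).mul (cg i).continuous).integrable_of_hasCompactSupport ((sη i).mul_right)
  have I2 : ∀ i, Integrable (fun x => η x * pd i (fun y => Real.exp (-f y) * pd i w y) x) :=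
    fun i => (hη.continuous.mul (cdg i)).integrable_of_hasCompactSupport (hc.mul_right)
  have I3 : ∀ i, Integrable (fun x => η x * (Real.exp (-f x) * pd i w x)) :=
    fun i => (hη.continuous.mul (cg i).continuous).integrable_of_hasCompactSupport (hc.mul_right)
  have key : ∀ i, ∫ x, η x * pd i (fun y => Real.exp (-f y) * pd i w y) x =
      -∫ x, pd i η x * (Real.exp (-f x) * pd i w x) := by
    intro i
    exact integral_mul_fderiv_eq_neg_fderiv_mul_of_integrable (I1 i) (I2 i) (I3 i)
      (fun x _ => hη.differentiable (by norm_num) x)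
      (fun x _ => (cg i).differentiable (by norm_num) x)
  have e1 : ∫ x, η x * (Real.exp (-f x) * wL f w x) =
      (∫ x, η x * pd 0 (fun y => Real.exp (-f y) * pd 0 w y) x) +
      ∫ x, η x * pd 1 (fun y => Real.exp (-f y) * pd 1 w y) x := by
    rw [← integral_add (I2 0) (I2 1)]
    congr 1; funext x
    rw [dg, dg, wL]; ring
  have e2 : ∫ x, Real.exp (-f x) * (pd 0 η x * pd 0 w x + pd 1 η x * pd 1 w x) =
      (∫ x, pd 0 η x * (Real.exp (-f x) * pd 0 w x)) +
      ∫ x, pd 1 η x * (Real.exp (-f x) * pd 1 w x) := by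
    rw [← integral_add (I1 0) (I1 1)]
    congr 1; funext x; ring
  rw [e1, e2, key, key]; ring

lemma cutoff (o : E2) : ∃ M : ℝ, 0 < M ∧ ∃ η : ℝ → E2 → ℝ, ∀ R : ℝ, 0 < R →
    ContDiff ℝ 1 (η R) ∧ HasCompactSupport (η R) ∧ (∀ x, 0 ≤ η R x) ∧ (∀ x, η R x ≤ 1) ∧
    (∀ x, ‖x - o‖ ≤ R → η R x = 1) ∧ (∀ x, 2 * R ≤ ‖x - o‖ → η R x = 0) ∧
    (∀ x, pd 0 (η R) x ^ 2 + pd 1 (η R) x ^ 2 ≤ M / R ^ 2) ∧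
    (∀ i x, ‖x - o‖ ≤ R ∨ 2 * R ≤ ‖x - o‖ → pd i (η R) x = 0) := by
  let ψ : ContDiffBump (0 : E2) := ⟨1, 2, by norm_num, by norm_num⟩
  have hψ : ContDiff ℝ 1 ψ := ψ.contDiff
  have hψc : HasCompactSupport ψ := ψ.hasCompactSupport
  obtain ⟨B, hB⟩ := (hψ.fderiv_right (m := 0) (by norm_num)).continuous.bounded_above_of_compact_support
    (hψc.fderiv ℝ)
  have hB0 : 0 ≤ B := (norm_nonneg _).trans (hB 0)
  refine ⟨2 * B ^ 2 + 1, by positivity, fun R x => ψ (R⁻¹ • (x - o)), ?_⟩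
  intro R hR
  have hn : ∀ x : E2, ‖R⁻¹ • (x - o)‖ = ‖x - o‖ / R := by
    intro x; rw [norm_smul, norm_inv, Real.norm_of_nonneg hR.le]; ring
  have hone : ∀ x, ‖x - o‖ ≤ R → ψ (R⁻¹ • (x - o)) = 1 := by
    intro x hx
    apply ψ.one_of_mem_closedBall
    rw [mem_closedBall_zero_iff, hn]
    exact (div_le_one hR).2 hx
  have hzero : ∀ x, 2 * R ≤ ‖x - o‖ → ψ (R⁻¹ • (x - o)) = 0 := by
    intro x hx
    apply ψ.zero_of_le_dist
    rw [dist_zero_right, hn]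
    exact (le_div_iff₀ hR).2 hx
  have hd : ∀ x, HasFDerivAt (fun x => ψ (R⁻¹ • (x - o)))
      ((fderiv ℝ ψ (R⁻¹ • (x - o))).comp (R⁻¹ • ContinuousLinearMap.id ℝ E2)) x := by
    intro x
    have h1 : HasFDerivAt (fun x : E2 => R⁻¹ • (x - o)) (R⁻¹ • ContinuousLinearMap.id ℝ E2) x :=
      ((hasFDerivAt_id x).sub_const o).const_smul R⁻¹
    exact (hψ.differentiable (by norm_num) _).hasFDerivAt.comp x h1
  have hbd : ∀ i x, |pd i (fun x => ψ (R⁻¹ • (x - o))) x| ≤ B / R := by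
    intro i x
    unfold pd
    rw [(hd x).fderiv]
    simp only [ContinuousLinearMap.comp_apply, FunLike.coe_smul, Pi.smul_apply,
      ContinuousLinearMap.coe_id', id, map_smul, smul_eq_mul, abs_mul, abs_inv, abs_of_pos hR]
    have := (fderiv ℝ ψ (R⁻¹ • (x - o))).le_opNorm (EuclideanSpace.single i 1)
    simp only [EuclideanSpace.norm_single, norm_one, mul_one, Real.norm_eq_abs] at this
    rw [div_eq_inv_mul]
    exact mul_le_mul_of_nonneg_left (this.trans (hB _)) (by positivity)
  refine ⟨?_, ?_, fun x => ψ.nonneg, fun x => ψ.le_one, hone, hzero, ?_, ?_⟩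
  · exact hψ.comp (by fun_prop)
  · apply HasCompactSupport.intro (isCompact_closedBall o (2 * R))
    intro x hx
    apply hzero
    rw [mem_closedBall_iff_norm] at hx
    linarith
  · intro x
    have a := sq_le_sq' (abs_le.1 (hbd 0 x)).1 (abs_le.1 (hbd 0 x)).2
    have b := sq_le_sq' (abs_le.1 (hbd 1 x)).1 (abs_le.1 (hbd 1 x)).2
    have : (2 * B ^ 2 + 1) / R ^ 2 = (B / R) ^ 2 + (B / R) ^ 2 + 1 / R ^ 2 := by
      field_simp; ring
    rw [this]
    have : 0 < 1 / R ^ 2 := by positivity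
    linarith
  · intro i x hx
    unfold pd
    have : fderiv ℝ (fun x => ψ (R⁻¹ • (x - o))) x = 0 := by
      rcases hx with hx | hx
      · apply IsLocalMax.fderiv_eq_zero
        filter_upwards with y
        simp only [hone x hx]
        exact ψ.le_one
      · apply IsLocalMin.fderiv_eq_zero
        filter_upwards with y
        simp only [hzero x hx]
        exact ψ.nonneg
    rw [this]; simp

lemma quad_opt {q X Y : ℝ} (hq : 0 ≤ q) (hX : 0 ≤ X) (hY : 0 ≤ Y)
    (h : ∀ l : ℝ, 0 < l → q ≤ l * X + Y / l) : q ^ 2 ≤ 4 * X * Y := by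
  rcases hq.eq_or_lt with rfl | hq
  · simp; positivity
  rcases hX.eq_or_lt with rfl | hX
  · exfalso
    have hl : 0 < 2 * Y / q + 1 := by positivity
    have := h _ hl
    rw [mul_zero, zero_add, le_div_iff₀ hl] at this
    have e : q * (2 * Y / q + 1) = 2 * Y + q := by field_simp
    linarith
  · have hl : 0 < q / (2 * X) := by positivity
    have := h _ hl
    have e : q / (2 * X) * X + Y / (q / (2 * X)) = q / 2 + 2 * X * Y / q := by field_simp
    rw [e] at this
    have h2 : q / 2 ≤ 2 * X * Y / q := by linarith
    rw [le_div_iff₀ hq] at h2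
    nlinarith

lemma seq_zero {q g : ℕ → ℝ} {K : ℝ} (hK : 0 < K) (hg : ∀ k, 0 < g k) (hq : ∀ k, 0 ≤ q k)
    (h : ∀ k, q (k + 1) ^ 2 ≤ K * g k * (q (k + 1) - q k))
    (hs : ¬ Summable (fun k => 1 / g k)) (k : ℕ) : q k = 0 := by
  by_contra hne
  have hk : 0 < q k := lt_of_le_of_ne (hq k) (Ne.symm hne)
  have hm : Monotone q := by
    apply monotone_nat_of_le_succ
    intro n
    have := h n
    have h2 : 0 ≤ K * g n * (q (n + 1) - q n) := (sq_nonneg _).trans this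
    have := nonneg_of_mul_nonneg_right h2 (mul_pos hK (hg n))
    linarith
  apply hs
  rw [← summable_nat_add_iff k]
  have hb : ∀ n, ∑ j ∈ Finset.range n, 1 / g (j + k) ≤ K * (1 / q k - 1 / q (n + k)) := by
    intro n
    induction n with
    | zero => simp
    | succ n ih =>
      rw [Finset.sum_range_succ]
      have p1 : 0 < q (n + k) := hk.trans_le (hm (by omega))
      have h1 := h (n + k)
      have h3 : n + 1 + k = n + k + 1 := by ring
      rw [h3]
      have p2 : 0 < q (n + k + 1) := hk.trans_le (hm (by omega))
      have hle : q (n + k) ≤ q (n + k + 1) := hm (by omega)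
      have h2 : 1 / g (n + k) ≤ K * (1 / q (n + k) - 1 / q (n + k + 1)) := by
        rw [div_sub_div _ _ p1.ne' p2.ne', mul_div_assoc', div_le_div_iff₀ (hg _) (by positivity)]
        have : q (n + k) * q (n + k + 1) ≤ q (n + k + 1) ^ 2 := by nlinarith
        nlinarith
      nlinarith
  apply summable_of_sum_range_le (c := K * (1 / q k))
  · intro n
    have := hg (n + k)
    positivity
  · intro n
    refine (hb n).trans ?_
    have : 0 ≤ 1 / q (n + k) := by have := hq (n + k); positivity
    nlinarith

lemma not_summ {G : ℝ → ℝ} {Rs R0 : ℝ} (hRs : 0 < Rs) (hR0 : Rs ≤ R0)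
    (hGpos : ∀ t, Rs ≤ t → 0 < G t)
    (hGmono : ∀ s t, Rs ≤ s → s ≤ t → G s ≤ G t)
    (hGdiv : (∫⁻ t in Set.Ioi Rs, ENNReal.ofReal (1 / (t * G t))) = ⊤) :
    ¬ Summable (fun k : ℕ => 1 / G (R0 * 2 ^ k)) := by
  intro hs
  have hR0p : 0 < R0 := hRs.trans_le hR0
  have hpw : ∀ k : ℕ, R0 ≤ R0 * 2 ^ k := fun k =>
    le_mul_of_one_le_right hR0p.le (one_le_pow₀ (by norm_num))
  have hcov : Set.Ioi Rs ⊆ Set.Ioc Rs R0 ∪ ⋃ k : ℕ, Set.Ioc (R0 * 2 ^ k) (R0 * 2 ^ (k + 1)) := by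
    intro t ht
    rcases le_or_gt t R0 with h | h
    · exact Or.inl ⟨ht, h⟩
    · right
      have hex : ∃ n : ℕ, t ≤ R0 * 2 ^ n := by
        obtain ⟨n, hn⟩ := pow_unbounded_of_one_lt (t / R0) (one_lt_two)
        refine ⟨n, ?_⟩
        rw [div_lt_iff₀ hR0p] at hn
        linarith
      classical
      have hspec := Nat.find_spec hex
      have hn0 : Nat.find hex ≠ 0 := by
        intro h0
        rw [h0] at hspec
        simp at hspec
        linarith
      obtain ⟨m, hm⟩ := Nat.exists_eq_succ_of_ne_zero hn0
      have hmin := Nat.find_min hex (m := m) (by omega)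
      rw [hm] at hspec
      exact Set.mem_iUnion.2 ⟨m, not_le.1 hmin, hspec⟩
  have hpiece : ∀ a b : ℝ, Rs ≤ a → a ≤ b →
      ∫⁻ t in Set.Ioc a b, ENNReal.ofReal (1 / (t * G t)) ≤
        ENNReal.ofReal ((b - a) / (a * G a)) := by
    intro a b ha hab
    have hap : 0 < a := hRs.trans_le ha
    have hGa := hGpos a ha
    calc ∫⁻ t in Set.Ioc a b, ENNReal.ofReal (1 / (t * G t))
        ≤ ∫⁻ t in Set.Ioc a b, ENNReal.ofReal (1 / (a * G a)) := by
          apply setLIntegral_mono' measurableSet_Ioc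
          intro t ht
          apply ENNReal.ofReal_le_ofReal
          apply one_div_le_one_div_of_le (by positivity)
          have := hGmono a t ha ht.1.le
          exact mul_le_mul ht.1.le this hGa.le (hap.le.trans ht.1.le)
      _ = ENNReal.ofReal ((b - a) / (a * G a)) := by
          rw [setLIntegral_const, Real.volume_Ioc, ← ENNReal.ofReal_mul (by positivity)]
          congr 1; ring
  have hlt : (∫⁻ t in Set.Ioi Rs, ENNReal.ofReal (1 / (t * G t))) < ⊤ := by
    calc (∫⁻ t in Set.Ioi Rs, ENNReal.ofReal (1 / (t * G t)))
        ≤ ∫⁻ t in Set.Ioc Rs R0 ∪ ⋃ k : ℕ, Set.Ioc (R0 * 2 ^ k) (R0 * 2 ^ (k + 1)),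
            ENNReal.ofReal (1 / (t * G t)) := lintegral_mono_set hcov
      _ ≤ (∫⁻ t in Set.Ioc Rs R0, ENNReal.ofReal (1 / (t * G t))) +
          ∫⁻ t in ⋃ k : ℕ, Set.Ioc (R0 * 2 ^ k) (R0 * 2 ^ (k + 1)),
            ENNReal.ofReal (1 / (t * G t)) := lintegral_union_le _ _ _
      _ ≤ ENNReal.ofReal ((R0 - Rs) / (Rs * G Rs)) +
          ∑' k : ℕ, ENNReal.ofReal (1 / G (R0 * 2 ^ k)) := by
          apply add_le_add (hpiece _ _ le_rfl hR0)
          refine (lintegral_iUnion_le _ _).trans (ENNReal.tsum_le_tsum fun k => ?_)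
          have hk := hpw k
          have hp : 0 < R0 * 2 ^ k := by positivity
          have hG := hGpos (R0 * 2 ^ k) (hR0.trans hk)
          have e : R0 * 2 ^ (k + 1) = 2 * (R0 * 2 ^ k) := by ring
          rw [e]
          refine (hpiece _ _ (hR0.trans hk) (by linarith)).trans (le_of_eq ?_)
          congr 1
          have h3 : 2 * (R0 * 2 ^ k) - R0 * 2 ^ k = R0 * 2 ^ k := by ring
          rw [h3]
          rw [div_eq_div_iff (by positivity) (by positivity)]; ring
      _ < ⊤ := by
          rw [← ENNReal.ofReal_tsum_of_nonneg _ hs]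
          · exact ENNReal.add_lt_top.2 ⟨ENNReal.ofReal_lt_top, ENNReal.ofReal_lt_top⟩
          · intro k
            have := hGpos (R0 * 2 ^ k) (hR0.trans (hpw k))
            positivity
  rw [hGdiv] at hlt
  exact lt_irrefl _ hlt

lemma ibp_sq {f w η : E2 → ℝ} (hf : ContDiff ℝ 2 f) (hw : ContDiff ℝ 2 w) (hη : ContDiff ℝ 1 η)
    (hc : HasCompactSupport η) :
    ∫ x, η x ^ 2 * (Real.exp (-f x) * wL f w x) =
      ∫ x, Real.exp (-f x) * (-(2 * η x * (pd 0 η x * pd 0 w x + pd 1 η x * pd 1 w x))) := by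
  have dη : Differentiable ℝ η := hη.differentiable (by norm_num)
  have h := ibp (η := fun x => η x * η x) hf hw (hη.mul hη) (hc.mul_right)
  have e : ∀ i x, pd i (fun x => η x * η x) x = 2 * η x * pd i η x := by
    intro i x
    rw [pd_mul (dη x) (dη x)]; ring
  calc _ = ∫ x, η x * η x * (Real.exp (-f x) * wL f w x) := by
        congr 1; funext x; ring
    _ = _ := h
    _ = _ := by
        rw [← integral_neg]
        congr 1; funext x; rw [e, e]; ring

lemma wL_continuous {f w : E2 → ℝ} (hf : ContDiff ℝ 2 f) (hw : ContDiff ℝ 2 w) :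
    Continuous (wL f w) := by
  have a : ∀ i, Continuous (pd i (pd i w)) := fun i =>
    (pd_contDiff (m := 0) (pd_contDiff (m := 1) hw (by norm_num) i) (by norm_num) i).continuous
  have b : ∀ i, Continuous (pd i w) := fun i =>
    (pd_contDiff (m := 1) hw (by norm_num) i).continuous
  have c : ∀ i, Continuous (pd i f) := fun i =>
    (pd_contDiff (m := 1) hf (by norm_num) i).continuous
  unfold wL
  exact ((a 0).add (a 1)).sub (((c 0).mul (b 0)).add ((c 1).mul (b 1)))

/-- elementary Young inequality used twice -/
lemma young {a0 a1 b0 b1 A B S e l : ℝ} (hl : 0 < l) (hB : 0 < B)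
    (hb : b0 ^ 2 + b1 ^ 2 ≤ B * S) (ha : a0 ^ 2 + a1 ^ 2 = A) :
    -(2 * e * (a0 * b0 + a1 * b1)) ≤ l * (e ^ 2 * S) + A * B / l := by
  have h1 : 0 ≤ (l * e * b0 + B * a0) ^ 2 + (l * e * b1 + B * a1) ^ 2 := by positivity
  have h2 : (l * e) ^ 2 * (b0 ^ 2 + b1 ^ 2) ≤ (l * e) ^ 2 * (B * S) :=
    mul_le_mul_of_nonneg_left hb (sq_nonneg _)
  have h3 : 0 ≤ (l * B) * (l * (e ^ 2 * S) + A * B / l + 2 * e * (a0 * b0 + a1 * b1)) := by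
    have : (l * B) * (l * (e ^ 2 * S) + A * B / l + 2 * e * (a0 * b0 + a1 * b1)) =
      (l * e) ^ 2 * (B * S) + B ^ 2 * A + 2 * l * e * B * (a0 * b0 + a1 * b1) := by
      field_simp
    rw [this, ← ha]
    nlinarith
  have := nonneg_of_mul_nonneg_right h3 (mul_pos hl hB)
  linarith

lemma wL_zero {f v : E2 → ℝ} (hf : ContDiff ℝ 2 f) (hconv : ConvexOn ℝ Set.univ f)
    (hv : ContDiff ℝ 3 v) (hpos : ∀ x, 0 < v x)
    (heq : ∀ x, wL f v x = Pf v x)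
    (hD : ∀ x, 0 ≤ pd 0 f x * pd 0 v x + pd 1 f x * pd 1 v x)
    (o : E2) (C : ℝ) (hC : 0 < C)
    (hvol : ∀ R : ℝ, 1 ≤ R → (∫ x in Metric.ball o R, Real.exp (-f x)) ≤ C * R ^ 2)
    (Rs : ℝ) (hRs : 0 < Rs) (G : ℝ → ℝ)
    (hGpos : ∀ t, Rs ≤ t → 0 < G t)
    (hGmono : ∀ s t, Rs ≤ s → s ≤ t → G s ≤ G t)
    (hGdiv : (∫⁻ t in Set.Ioi Rs, ENNReal.ofReal (1 / (t * G t))) = ⊤)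
    (hle : ∀ x : E2, Rs ≤ ‖x - o‖ → v x ≤ ‖x - o‖ ^ 2 * G ‖x - o‖) (x : E2) :
    wL f (Pf v) x = 0 := by
  obtain ⟨M, hM, η, hη⟩ := cutoff o
  have hP := Pf_contDiff hv hpos
  have hP0 := Pf_pos hpos
  have hK := key hf hconv hv hpos heq hD
  have hv2 : ContDiff ℝ 2 v := hv.of_le (by norm_num)
  have cS := wL_continuous hf hP
  have cP := hP.continuous
  have cv := hv.continuous
  have ch : Continuous (fun x => Real.exp (-f x)) := (hf.continuous.neg).rexp
  have chP : Continuous (fun x => Real.exp (-f x) * Pf v x) := ch.mul cP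
  have chS : Continuous (fun x => Real.exp (-f x) * wL f (Pf v) x) := ch.mul cS
  have chv : Continuous (fun x => Real.exp (-f x) * v x) := ch.mul cv
  have cpv : ∀ i, Continuous (pd i v) := fun i =>
    (pd_contDiff (m := 1) hv (by norm_num) i).continuous
  have cpP : ∀ i, Continuous (pd i (Pf v)) := fun i =>
    (pd_contDiff (m := 1) hP (by norm_num) i).continuous
  have cη : ∀ R, 0 < R → Continuous (η R) := fun R hR => (hη R hR).1.continuous
  have cpη : ∀ i R, 0 < R → Continuous (pd i (η R)) := fun i R hR =>
    (pd_contDiff (m := 0) (hη R hR).1 (by norm_num) i).continuous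
  have Iη : ∀ R, 0 < R → ∀ w : E2 → ℝ, Continuous w → Integrable (fun x => η R x ^ 2 * w x) := by
    intro R hR w hw
    refine (((cη R hR).pow 2).mul hw).integrable_of_hasCompactSupport ?_
    have : HasCompactSupport (fun x => η R x ^ 2) :=
      (hη R hR).2.1.comp_left (g := fun t : ℝ => t ^ 2) (by simp)
    exact this.mul_right
  have Igη : ∀ R, 0 < R → ∀ w : E2 → ℝ, Continuous w →
      Integrable (fun x => (pd 0 (η R) x ^ 2 + pd 1 (η R) x ^ 2) * w x) := by
    intro R hR w hw
    refine ((((cpη 0 R hR).pow 2).add ((cpη 1 R hR).pow 2)).mul hw).integrable_of_hasCompactSupport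
      ?_
    apply HasCompactSupport.intro (isCompact_closedBall o (2 * R))
    intro x hx
    rw [mem_closedBall_iff_norm] at hx
    have h := (hη R hR).2.2.2.2.2.2.2
    have h0 := h 0 x (Or.inr (by linarith))
    have h1 := h 1 x (Or.inr (by linarith))
    simp [h0, h1]
  have Icr : ∀ R, 0 < R → ∀ w : Fin 2 → E2 → ℝ, (∀ i, Continuous (w i)) →
      Integrable (fun x => Real.exp (-f x) *
        (-(2 * η R x * (pd 0 (η R) x * w 0 x + pd 1 (η R) x * w 1 x)))) := by
    intro R hR w hw
    have c : Continuous (fun x => Real.exp (-f x) *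
        (-(2 * η R x * (pd 0 (η R) x * w 0 x + pd 1 (η R) x * w 1 x)))) :=
      ch.mul ((continuous_const.mul (cη R hR)).mul (((cpη 0 R hR).mul (hw 0)).add
        ((cpη 1 R hR).mul (hw 1)))).neg
    refine c.integrable_of_hasCompactSupport ?_
    apply HasCompactSupport.intro (isCompact_closedBall o (2 * R))
    intro x hx
    rw [mem_closedBall_iff_norm] at hx
    rw [(hη R hR).2.2.2.2.2.1 x (by linarith)]
    ring
  have hR0 : 0 < max Rs 1 := lt_max_of_lt_left hRs
  -- first energy estimate
  have E1 : ∀ R, max Rs 1 ≤ R → ∫ x, η R x ^ 2 * (Real.exp (-f x) * Pf v x) ≤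
      64 * M * C * R ^ 2 * G (2 * R) := by
    intro R hR
    have hRp : 0 < R := hR0.trans_le hR
    have hR1 : 1 ≤ R := (le_max_right _ _).trans hR
    have hRR : Rs ≤ R := (le_max_left _ _).trans hR
    obtain ⟨h1, h2, h3, h4, h5, h6, h7, h8⟩ := hη R hRp
    have hib := ibp_sq hf hv2 h1 h2
    simp only [heq] at hib
    have hG2 : 0 < G (2 * R) := hGpos _ (by linarith)
    have s1 : ∫ x, η R x ^ 2 * (Real.exp (-f x) * Pf v x) ≤
        ∫ x, (1 / 2 * (η R x ^ 2 * (Real.exp (-f x) * Pf v x)) +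
          2 * ((pd 0 (η R) x ^ 2 + pd 1 (η R) x ^ 2) * (Real.exp (-f x) * v x))) := by
      rw [hib]
      apply integral_mono (Icr R hRp (fun i => pd i v) cpv)
        (((Iη R hRp _ chP).const_mul _).add ((Igη R hRp _ chv).const_mul _))
      intro x
      have hPv : Pf v x * v x = pd 0 v x ^ 2 + pd 1 v x ^ 2 + 1 / 2 := by
        unfold Pf
        have := (hpos x).ne'
        field_simp
      have := young (a0 := pd 0 (η R) x) (a1 := pd 1 (η R) x) (b0 := pd 0 v x) (b1 := pd 1 v x)
        (S := Pf v x) (e := η R x) (l := 1 / 2) (by norm_num) (hpos x) (by nlinarith) rfl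
      have h9 := mul_le_mul_of_nonneg_left this (Real.exp_pos (-f x)).le
      refine h9.trans (le_of_eq ?_)
      try simp only [Pi.add_apply]
      ring
    rw [integral_add ((Iη R hRp _ chP).const_mul _) ((Igη R hRp _ chv).const_mul _),
      integral_const_mul, integral_const_mul] at s1
    have s2 : ∫ x, (pd 0 (η R) x ^ 2 + pd 1 (η R) x ^ 2) * (Real.exp (-f x) * v x) ≤
        16 * M * C * R ^ 2 * G (2 * R) := by
      have Ib : IntegrableOn (fun x => Real.exp (-f x)) (Metric.ball o (2 * R)) :=
        (ch.continuousOn.integrableOn_compact (isCompact_closedBall o (2 * R))).mono_set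
          Metric.ball_subset_closedBall
      calc ∫ x, (pd 0 (η R) x ^ 2 + pd 1 (η R) x ^ 2) * (Real.exp (-f x) * v x)
          ≤ ∫ x, (Metric.ball o (2 * R)).indicator
              (fun x => 4 * M * G (2 * R) * Real.exp (-f x)) x := by
            apply integral_mono (Igη R hRp _ chv)
              ((integrable_indicator_iff measurableSet_ball).2 (Ib.const_mul _))
            intro x
            by_cases hx : x ∈ Metric.ball o (2 * R)
            · simp only [Set.indicator_of_mem hx]
              rw [mem_ball_iff_norm] at hx
              by_cases hx2 : ‖x - o‖ ≤ R
              · rw [h8 0 x (Or.inl hx2), h8 1 x (Or.inl hx2)]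
                have := Real.exp_pos (-f x)
                simp only [ne_eq, OfNat.ofNat_ne_zero, not_false_eq_true, zero_pow, add_zero,
                  zero_mul]
                positivity
              · push Not at hx2
                have hvx : v x ≤ (2 * R) ^ 2 * G (2 * R) := by
                  refine (hle x (by linarith)).trans ?_
                  have hg := hGmono ‖x - o‖ (2 * R) (by linarith) hx.le
                  have hg0 := hGpos ‖x - o‖ (by linarith)
                  have : ‖x - o‖ ^ 2 ≤ (2 * R) ^ 2 := by
                    apply pow_le_pow_left₀ (norm_nonneg _) hx.le
                  exact mul_le_mul this hg hg0.le (by positivity)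
                calc (pd 0 (η R) x ^ 2 + pd 1 (η R) x ^ 2) * (Real.exp (-f x) * v x)
                    ≤ M / R ^ 2 * (Real.exp (-f x) * ((2 * R) ^ 2 * G (2 * R))) := by
                      apply mul_le_mul (h7 x) _ _ (by positivity)
                      · exact mul_le_mul_of_nonneg_left hvx (Real.exp_pos _).le
                      · exact (mul_pos (Real.exp_pos _) (hpos x)).le
                  _ = 4 * M * G (2 * R) * Real.exp (-f x) := by field_simp; ring
            · simp only [Set.indicator_of_notMem hx]
              rw [mem_ball_iff_norm, not_lt] at hx
              rw [h8 0 x (Or.inr hx), h8 1 x (Or.inr hx)]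
              simp
        _ = 4 * M * G (2 * R) * ∫ x in Metric.ball o (2 * R), Real.exp (-f x) := by
            rw [integral_indicator measurableSet_ball, integral_const_mul]
        _ ≤ 4 * M * G (2 * R) * (C * (2 * R) ^ 2) :=
            mul_le_mul_of_nonneg_left (hvol _ (by linarith)) (by positivity)
        _ = _ := by ring
    linarith
  -- second energy estimate
  set Q : ℝ → ℝ := fun R => ∫ x, η R x ^ 2 * (Real.exp (-f x) * wL f (Pf v) x) with hQ
  have Q0 : ∀ R, 0 ≤ Q R := fun R => integral_nonneg fun x =>
    mul_nonneg (sq_nonneg _) (mul_nonneg (Real.exp_pos _).le (hK x).2.1)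
  have hsq : ∀ R, 0 < R → ∀ x, η R x ^ 2 ≤ η (2 * R) x ^ 2 := by
    intro R hRp x
    obtain ⟨h1, h2, h3, h4, h5, h6, h7, h8⟩ := hη R hRp
    obtain ⟨k1, k2, k3, k4, k5, k6, k7, k8⟩ := hη (2 * R) (by linarith)
    rcases le_total ‖x - o‖ (2 * R) with h | h
    · rw [k5 x h]
      exact pow_le_pow_left₀ (h3 x) (h4 x) 2
    · rw [h6 x h, zero_pow two_ne_zero]
      exact sq_nonneg _
  have E2 : ∀ R, max Rs 1 ≤ R → Q (2 * R) ^ 2 ≤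
      2048 * M ^ 2 * C * G (8 * R) * (Q (2 * R) - Q R) := by
    intro R hR
    have hRp : 0 < R := hR0.trans_le hR
    have hRp2 : 0 < 2 * R := by linarith
    have hRp4 : 0 < 4 * R := by linarith
    have hRR : Rs ≤ R := (le_max_left _ _).trans hR
    have hG8 : 0 < G (8 * R) := hGpos _ (by linarith)
    obtain ⟨h1, h2, h3, h4, h5, h6, h7, h8⟩ := hη R hRp
    obtain ⟨k1, k2, k3, k4, k5, k6, k7, k8⟩ := hη (2 * R) hRp2
    obtain ⟨l1, l2, l3, l4, l5, l6, l7, l8⟩ := hη (4 * R) hRp4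
    have hS := fun x => (hK x).2.1
    have hX : Q (2 * R) - Q R = ∫ x, (η (2 * R) x ^ 2 * (Real.exp (-f x) * wL f (Pf v) x) -
        η R x ^ 2 * (Real.exp (-f x) * wL f (Pf v) x)) := by
      rw [integral_sub (Iη _ hRp2 _ chS) (Iη _ hRp _ chS)]
    have IX : Integrable (fun x => η (2 * R) x ^ 2 * (Real.exp (-f x) * wL f (Pf v) x) -
        η R x ^ 2 * (Real.exp (-f x) * wL f (Pf v) x)) :=
      (Iη _ hRp2 _ chS).sub (Iη _ hRp _ chS)
    have X0 : 0 ≤ Q (2 * R) - Q R := by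
      rw [hX]
      apply integral_nonneg
      intro x
      have h9 := mul_le_mul_of_nonneg_right (hsq R hRp x)
        (mul_nonneg (Real.exp_pos (-f x)).le (hS x))
      simp only [Pi.zero_apply]
      linarith
    have hY : ∫ x, (pd 0 (η (2 * R)) x ^ 2 + pd 1 (η (2 * R)) x ^ 2) * (Real.exp (-f x) * Pf v x)
        ≤ 256 * M ^ 2 * C * G (8 * R) := by
      calc ∫ x, (pd 0 (η (2 * R)) x ^ 2 + pd 1 (η (2 * R)) x ^ 2) * (Real.exp (-f x) * Pf v x)
          ≤ ∫ x, M / (2 * R) ^ 2 * (η (4 * R) x ^ 2 * (Real.exp (-f x) * Pf v x)) := by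
            apply integral_mono (Igη _ hRp2 _ chP)
              ((Iη _ hRp4 _ chP).const_mul _)
            intro x
            have hp := mul_pos (Real.exp_pos (-f x)) (hP0 x)
            try simp only [Pi.add_apply]
            rcases le_total ‖x - o‖ (4 * R) with h | h
            · rw [l5 x h, one_pow, one_mul]
              exact mul_le_mul_of_nonneg_right (k7 x) hp.le
            · rw [k8 0 x (Or.inr (by linarith)), k8 1 x (Or.inr (by linarith))]
              simp only [ne_eq, OfNat.ofNat_ne_zero, not_false_eq_true, zero_pow, add_zero,
                  zero_mul]
              positivity
        _ = M / (2 * R) ^ 2 * ∫ x, η (4 * R) x ^ 2 * (Real.exp (-f x) * Pf v x) :=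
            integral_const_mul _ _
        _ ≤ M / (2 * R) ^ 2 * (64 * M * C * (4 * R) ^ 2 * G (2 * (4 * R))) :=
            mul_le_mul_of_nonneg_left (E1 (4 * R) (by linarith)) (by positivity)
        _ = _ := by
            have : 2 * (4 * R) = 8 * R := by ring
            rw [this]; field_simp; ring
    have main : ∀ l : ℝ, 0 < l → Q (2 * R) ≤ l * (Q (2 * R) - Q R) +
        (512 * M ^ 2 * C * G (8 * R)) / l := by
      intro l hl
      have s1 : Q (2 * R) ≤ ∫ x, (l * (η (2 * R) x ^ 2 * (Real.exp (-f x) * wL f (Pf v) x) -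
          η R x ^ 2 * (Real.exp (-f x) * wL f (Pf v) x)) + 2 / l *
          ((pd 0 (η (2 * R)) x ^ 2 + pd 1 (η (2 * R)) x ^ 2) * (Real.exp (-f x) * Pf v x))) := by
        have e : Q (2 * R) = _ := ibp_sq hf hP k1 k2
        rw [e]
        apply integral_mono (Icr _ hRp2 (fun i => pd i (Pf v)) cpP)
          ((IX.const_mul _).add ((Igη _ hRp2 _ chP).const_mul _))
        intro x
        try simp only [Pi.add_apply]
        have hp := Real.exp_pos (-f x)
        rcases le_total ‖x - o‖ (2 * R) with h | h
        · rw [k8 0 x (Or.inl h), k8 1 x (Or.inl h)]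
          have h9 := mul_le_mul_of_nonneg_right (hsq R hRp x)
            (mul_nonneg (Real.exp_pos (-f x)).le (hS x))
          have : 0 ≤ l * (η (2 * R) x ^ 2 * (Real.exp (-f x) * wL f (Pf v) x) -
            η R x ^ 2 * (Real.exp (-f x) * wL f (Pf v) x)) := mul_nonneg hl.le (by linarith)
          simpa using this
        · rw [h6 x h]
          have := young (a0 := pd 0 (η (2 * R)) x) (a1 := pd 1 (η (2 * R)) x)
            (b0 := pd 0 (Pf v) x) (b1 := pd 1 (Pf v) x)
            (S := wL f (Pf v) x) (e := η (2 * R) x) (l := l) (B := 2 * Pf v x) hl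
            (by linarith [hP0 x]) (hK x).1 rfl
          have h9 := mul_le_mul_of_nonneg_left this hp.le
          refine h9.trans (le_of_eq ?_)
          ring
      rw [integral_add (IX.const_mul _) ((Igη _ hRp2 _ chP).const_mul _),
        integral_const_mul, integral_const_mul, ← hX] at s1
      have h9 := mul_le_mul_of_nonneg_left hY (show 0 ≤ 2 / l by positivity)
      have : 2 / l * (256 * M ^ 2 * C * G (8 * R)) = (512 * M ^ 2 * C * G (8 * R)) / l := by ring
      linarith
    have := quad_opt (Q0 _) X0 (by positivity) main
    linarith
  -- conclude
  have hns := not_summ (R0 := 8 * max Rs 1) hRs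
    ((le_max_left Rs 1).trans (by linarith)) hGpos hGmono hGdiv
  have hpw : ∀ k : ℕ, max Rs 1 ≤ max Rs 1 * 2 ^ k := fun k =>
    le_mul_of_one_le_right hR0.le (one_le_pow₀ (by norm_num))
  have hz := seq_zero (q := fun k => Q (max Rs 1 * 2 ^ k)) (K := 2048 * M ^ 2 * C)
    (g := fun k => G (8 * max Rs 1 * 2 ^ k)) (by positivity)
    (fun k => hGpos _ (by have := hpw k; have := le_max_left Rs 1; nlinarith)) (fun k => Q0 _)
    (fun k => by
      have := E2 _ (hpw k)
      have e1 : max Rs 1 * 2 ^ (k + 1) = 2 * (max Rs 1 * 2 ^ k) := by ring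
      have e2 : 8 * max Rs 1 * 2 ^ k = 8 * (max Rs 1 * 2 ^ k) := by ring
      simp only [e1, e2]
      exact this) hns
  obtain ⟨k, hk⟩ : ∃ k : ℕ, ‖x - o‖ ≤ max Rs 1 * 2 ^ k := by
    obtain ⟨n, hn⟩ := pow_unbounded_of_one_lt (‖x - o‖) (one_lt_two)
    refine ⟨n, hn.le.trans ?_⟩
    exact le_mul_of_one_le_left (by positivity) (le_max_right _ _)
  have hkp : 0 < max Rs 1 * 2 ^ k := by positivity
  have hzk : (∫ x, η (max Rs 1 * 2 ^ k) x ^ 2 * (Real.exp (-f x) * wL f (Pf v) x)) = 0 := hz k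
  have hcont : Continuous
      (fun x => η (max Rs 1 * 2 ^ k) x ^ 2 * (Real.exp (-f x) * wL f (Pf v) x)) :=
    ((cη _ hkp).pow 2).mul chS
  rw [integral_eq_zero_iff_of_nonneg (fun x =>
    mul_nonneg (sq_nonneg _) (mul_nonneg (Real.exp_pos _).le (hK x).2.1))
    (Iη _ hkp _ chS), hcont.ae_eq_iff_eq volume continuous_zero] at hzk
  have := congrFun hzk x
  simp only [Pi.zero_apply] at this
  rw [(hη _ hkp).2.2.2.2.1 x hk, one_pow, one_mul] at this
  exact (mul_eq_zero.1 this).resolve_left (Real.exp_pos _).ne'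

theorem liouville_equation_rigidity
    (f u : EuclideanSpace ℝ (Fin 2) → ℝ)
    (hf : ContDiff ℝ 2 f) (hconv : ConvexOn ℝ Set.univ f)
    (hu : ContDiff ℝ 3 u)
    (heq : ∀ x, lapl u x - ⟪gradient f x, gradient u x⟫ + Real.exp (u x) = 0)
    (hdot : ∀ x, ⟪gradient f x, gradient u x⟫ ≤ 0)
    (o : EuclideanSpace ℝ (Fin 2)) (C : ℝ) (hC : 0 < C)
    (hvol : ∀ R : ℝ, 1 ≤ R → (∫ x in Metric.ball o R, Real.exp (-f x)) ≤ C * R ^ 2)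
    (Rs : ℝ) (hRs : 0 < Rs) (G : ℝ → ℝ)
    (hGpos : ∀ t, Rs ≤ t → 0 < G t)
    (hGmono : ∀ s t, Rs ≤ s → s ≤ t → G s ≤ G t)
    (hGdiv : (∫⁻ t in Set.Ioi Rs, ENNReal.ofReal (1 / (t * G t))) = ⊤)
    (hlow : ∀ x : EuclideanSpace ℝ (Fin 2), Rs ≤ ‖x - o‖ →
        -4 * Real.log (‖x - o‖ * Real.sqrt (G ‖x - o‖)) ≤ u x) :
    (∀ x y, f x = f y) ∧
    ∃ a : ℝ, 0 < a ∧ ∃ b : ℝ, 0 < b ∧ 8 * a * b = 1 ∧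
      ∃ x₀ : EuclideanSpace ℝ (Fin 2),
        ∀ x, u x = Real.log (1 / (a + b * ‖x - x₀‖ ^ 2) ^ 2) := by
  set v : E2 → ℝ := fun x => Real.exp (-(1 / 2) * u x) with hvdef
  have hv : ContDiff ℝ 3 v := (contDiff_const.mul hu).exp
  have hpos : ∀ x, 0 < v x := fun x => Real.exp_pos _
  have du : Differentiable ℝ u := hu.differentiable (by norm_num)
  have dv : Differentiable ℝ v := hv.differentiable (by norm_num)
  have df : Differentiable ℝ f := hf.differentiable (by norm_num)
  have du1 : ∀ i, Differentiable ℝ (pd i u) := fun i =>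
    (pd_contDiff (m := 2) hu (by norm_num) i).differentiable (by norm_num)
  have pv : ∀ i x, pd i v x = v x * (-(1 / 2) * pd i u x) := by
    intro i x
    rw [hvdef, pd_exp ((differentiableAt_const _).fun_mul (du x)),
      pd_mul (differentiableAt_const _) (du x), pd_const]
    ring
  have ppv : ∀ i x, pd i (pd i v) x =
      v x * (-(1 / 2) * pd i (pd i u) x + 1 / 4 * pd i u x ^ 2) := by
    intro i x
    have : pd i v = fun x => v x * (-(1 / 2) * pd i u x) := funext (pv i)
    rw [this, pd_mul (dv x) ((differentiableAt_const _).fun_mul (du1 i x)),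
      pd_mul (differentiableAt_const _) (du1 i x), pd_const, pv]
    ring
  have hve : ∀ x, v x ^ 2 * Real.exp (u x) = 1 := by
    intro x
    rw [hvdef]
    try simp only [Pi.add_apply]
    rw [← Real.exp_nat_mul, ← Real.exp_add]
    have : ((2 : ℕ) : ℝ) * (-(1 / 2) * u x) + u x = 0 := by push_cast; ring
    rw [this, Real.exp_zero]
  have hPv : ∀ x, Pf v x * v x = pd 0 v x ^ 2 + pd 1 v x ^ 2 + 1 / 2 := by
    intro x
    unfold Pf
    have := (hpos x).ne'
    field_simp
  have heqv : ∀ x, wL f v x = Pf v x := by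
    intro x
    have h := heq x
    rw [lapl_eq_s6 (hu.of_le (by norm_num)), inner_grad] at h
    have h1 := hPv x
    have h2 := hve x
    apply mul_right_cancel₀ (hpos x).ne'
    rw [h1]
    unfold wL
    rw [ppv, ppv, pv, pv]
    linear_combination (-(1 / 2) * v x ^ 2) * h + 1 / 2 * h2
  have hD : ∀ x, 0 ≤ pd 0 f x * pd 0 v x + pd 1 f x * pd 1 v x := by
    intro x
    have h := hdot x
    rw [inner_grad] at h
    rw [pv, pv]
    have := hpos x
    nlinarith
  have hle : ∀ x : E2, Rs ≤ ‖x - o‖ → v x ≤ ‖x - o‖ ^ 2 * G ‖x - o‖ := by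
    intro x hx
    have h := hlow x hx
    have hr : 0 < ‖x - o‖ := hRs.trans_le hx
    have hG := hGpos _ hx
    have hs : 0 < ‖x - o‖ * Real.sqrt (G ‖x - o‖) := mul_pos hr (Real.sqrt_pos.2 hG)
    have e : ‖x - o‖ ^ 2 * G ‖x - o‖ =
        Real.exp (2 * Real.log (‖x - o‖ * Real.sqrt (G ‖x - o‖))) := by
      have : (2:ℝ) * Real.log (‖x - o‖ * Real.sqrt (G ‖x - o‖)) =
        ((2 : ℕ) : ℝ) * Real.log (‖x - o‖ * Real.sqrt (G ‖x - o‖)) := by push_cast; ring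
      rw [this, Real.exp_nat_mul, Real.exp_log hs, mul_pow, Real.sq_sqrt hG.le]
    rw [e, hvdef]
    apply Real.exp_le_exp.2
    linarith
  have hS := wL_zero hf hconv hv hpos heqv hD o C hC hvol Rs hRs G hGpos hGmono hGdiv hle
  have hK := key hf hconv hv hpos heqv hD
  have hR := fun x => (hK x).2.2 (hS x)
  have zero_of : ∀ (w : E2 → ℝ) (x : E2), pd 0 w x = 0 → pd 1 w x = 0 → fderiv ℝ w x = 0 := by
    intro w x h0 h1
    ext y
    rw [fderiv_eq_pd, h0, h1]; simp
  have dP : Differentiable ℝ (Pf v) := (Pf_contDiff hv hpos).differentiable (by norm_num)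
  have hPc : ∀ x, Pf v x = Pf v 0 := by
    intro x
    apply is_const_of_fderiv_eq_zero dP
    intro y
    have h := (hK y).1
    rw [hS y, mul_zero] at h
    apply zero_of
    · exact pow_eq_zero_iff (two_ne_zero) |>.1
        (le_antisymm (by nlinarith [sq_nonneg (pd 1 (Pf v) y)]) (sq_nonneg _))
    · exact pow_eq_zero_iff (two_ne_zero) |>.1
        (le_antisymm (by nlinarith [sq_nonneg (pd 0 (Pf v) y)]) (sq_nonneg _))
  set c := Pf v 0 with hc
  have hcp : 0 < c := Pf_pos hpos 0
  have dv1 : ∀ i, Differentiable ℝ (pd i v) := fun i =>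
    (pd_contDiff (m := 2) hv (by norm_num) i).differentiable (by norm_num)
  have dcoord : ∀ i : Fin 2, Differentiable ℝ (fun x : E2 => x i) := fun i => by fun_prop
  have pcoord : ∀ (i j : Fin 2) (x : E2), pd j (fun x : E2 => x i) x = if i = j then 1 else 0 := by
    intro i j x
    unfold pd
    have : HasFDerivAt (fun x : E2 => x i) (EuclideanSpace.proj i : E2 →L[ℝ] ℝ) x :=
      (EuclideanSpace.proj i : E2 →L[ℝ] ℝ).hasFDerivAt
    rw [this.fderiv]
    simp
  have hs : ∀ x, pd 1 (pd 0 v) x = 0 := fun x => by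
    rw [pd_comm (hv.of_le (by norm_num)) x 1 0]; exact (hR x).2.1
  have hgrad : ∀ i x, pd i v x = c / 2 * x i + pd i v 0 := by
    intro i x
    have dd : Differentiable ℝ (fun x : E2 => pd i v x - c / 2 * x i) := fun x =>
      (dv1 i x).fun_sub ((differentiableAt_const _).fun_mul (dcoord i x))
    have h := is_const_of_fderiv_eq_zero dd (fun y => by
      have hj : ∀ j, pd j (fun x : E2 => pd i v x - c / 2 * x i) y = 
          pd j (pd i v) y - c / 2 * (if i = j then 1 else 0) := by
        intro j
        rw [pd_sub (dv1 i y) ((differentiableAt_const _).fun_mul (dcoord i y)),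
          pd_mul (differentiableAt_const _) (dcoord i y), pd_const, pcoord]
        ring
      obtain ⟨r1, r2, r3, r4⟩ := hR y
      rw [hPc] at r3 r4
      have r5 := hs y
      apply zero_of
      · rw [hj]; fin_cases i
        · simp [r3]
        · simpa using r2
      · rw [hj]; fin_cases i
        · simpa using r5
        · simp [r4]) x 0
    simp at h
    linarith
  set x₀ : E2 := !₂[-(2 / c) * pd 0 v 0, -(2 / c) * pd 1 v 0] with hx₀
  have hx0 : ∀ i, x₀ i = -(2 / c) * pd i v 0 := by
    intro i; fin_cases i <;> simp [hx₀]
  have hgrad' : ∀ i x, pd i v x = c / 2 * (x i - x₀ i) := by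
    intro i x
    rw [hgrad, hx0]; field_simp; ring
  have hnorm : ∀ x : E2, ‖x - x₀‖ ^ 2 = (x 0 - x₀ 0) ^ 2 + (x 1 - x₀ 1) ^ 2 := by
    intro x
    rw [EuclideanSpace.norm_sq_eq, Fin.sum_univ_two]
    simp
  constructor
  · have hf0 : ∀ x, f x = f x₀ := by
      intro x
      have hl : ∀ t : ℝ, HasDerivAt (fun t : ℝ => x₀ + t • (x - x₀)) (x - x₀) t := by
        intro t
        simpa using ((hasDerivAt_id t).smul_const (x - x₀)).const_add x₀
      have h1 : ∀ t : ℝ, HasDerivAt (fun t : ℝ => f (x₀ + t • (x - x₀)))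
          (fderiv ℝ f (x₀ + t • (x - x₀)) (x - x₀)) t := by
        intro t
        exact (df (x₀ + t • (x - x₀))).hasFDerivAt.comp_hasDerivAt t (hl t)
      obtain ⟨t, ht, he⟩ := exists_hasDerivAt_eq_slope (fun t : ℝ => f (x₀ + t • (x - x₀)))
        (fun t => fderiv ℝ f (x₀ + t • (x - x₀)) (x - x₀)) (zero_lt_one)
        (fun t _ => (h1 t).continuousAt.continuousWithinAt) (fun t _ => h1 t)
      have hz := (hR (x₀ + t • (x - x₀))).1
      rw [hgrad', hgrad'] at hz
      rw [fderiv_eq_pd] at he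
      have hz2 : (c / 2 * t) * ((x - x₀) 0 * pd 0 f (x₀ + t • (x - x₀)) +
          (x - x₀) 1 * pd 1 f (x₀ + t • (x - x₀))) = 0 := by
        rw [← hz]; simp; ring
      have ht0 := ht.1
      rw [(mul_eq_zero.1 hz2).resolve_left (by positivity)] at he
      simp at he
      linarith
    intro x y
    rw [hf0 x, hf0 y]
  · refine ⟨1 / (2 * c), by positivity, c / 4, by positivity, by field_simp; norm_num, x₀, ?_⟩
    intro x
    have h := hPv x
    rw [hPc, hgrad', hgrad'] at h
    have e : 1 / (2 * c) + c / 4 * ‖x - x₀‖ ^ 2 = v x := by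
      apply mul_left_cancel₀ hcp.ne'
      rw [h, hnorm]; field_simp; ring
    rw [e, one_div, Real.log_inv, Real.log_pow, hvdef]
    simp only [Real.log_exp]
    push_cast; ring
end
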